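/- arXiv:1408.3016 — 3 statements merged into one kernel-verified Lean document; each statement's English description precedes it below -/
import Mathlib

section
/- Let C ⊆ ℝ^m be a closed convex cone with C ≠ {0}, D ⊆ ℝ^n a closed convex cone, G ∈ ℝ^{n×m} a standard Gaussian matrix, g ∈ ℝ^m, g' ∈ ℝ^n independent standard Gaussian vectors, and γ a standard Gaussian real random variable independent of G. Then for every monotonically increasing Borel function f : ℝ → ℝ such that f(σ_{C→D}(G) + γ) and f(‖Proj_D(g')‖ − ‖Proj_C(g)‖) are integrable, E[ f(σ_{C→D}(G) + γ) ] ≥ E[ f(‖Proj_D(g')‖ − ‖Proj_C(g)‖) ]. -/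
open MeasureTheory ProbabilityTheory Metric Set
open scoped InnerProductSpace
open scoped Classical
open scoped Pointwise

noncomputable section
/-- Euclidean space `ℝ^k`. -/
abbrev Euc (k : ℕ) : Type := EuclideanSpace ℝ (Fin k)

/-- The linear action of a matrix `A ∈ ℝ^{n×m}` on Euclidean space, `x ↦ Ax`. -/
def mulE {m n : ℕ} (A : Matrix (Fin n) (Fin m) ℝ) (x : Euc m) : Euc n :=
  Matrix.toEuclideanLin A x

/-- The metric projection onto a set `S`: the point of `S` closest to `y`
(if a unique closest point characterizing property holds; junk value `0` otherwise). -/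
def metricProj {k : ℕ} (S : Set (Euc k)) (y : Euc k) : Euc k :=
  if h : ∃ z, z ∈ S ∧ ∀ w ∈ S, dist y z ≤ dist y w then h.choose else 0

/-- `C` is a closed convex cone (containing the origin). -/
def IsClosedConvexCone {k : ℕ} (C : Set (Euc k)) : Prop :=
  IsClosed C ∧ Convex ℝ C ∧ (∀ c : ℝ, 0 ≤ c → ∀ x ∈ C, c • x ∈ C) ∧ (0 : Euc k) ∈ C

/-- The polar cone `S° = {z | ⟨x,z⟩ ≤ 0 ∀ x ∈ S}`. -/
def polarCone {k : ℕ} (S : Set (Euc k)) : Set (Euc k) :=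
  {z | ∀ x ∈ S, ⟪x, z⟫_ℝ ≤ 0}

/-- The restricted norm `‖A‖_{C→D} = max_{x ∈ C ∩ S^{m-1}} ‖Proj_D (Ax)‖`. -/
def resNorm {m n : ℕ} (C : Set (Euc m)) (D : Set (Euc n)) (A : Matrix (Fin n) (Fin m) ℝ) : ℝ :=
  sSup ((fun x => ‖metricProj D (mulE A x)‖) '' (C ∩ sphere 0 1))

/-- The restricted singular value `σ_{C→D}(A) = min_{x ∈ C ∩ S^{m-1}} ‖Proj_D (Ax)‖`. -/
def resSval {m n : ℕ} (C : Set (Euc m)) (D : Set (Euc n)) (A : Matrix (Fin n) (Fin m) ℝ) : ℝ :=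
  sInf ((fun x => ‖metricProj D (mulE A x)‖) '' (C ∩ sphere 0 1))

/-- The restricted norm for arbitrary (not necessarily closed) cones:
`‖B‖_{K→K'} = sup { ⟨Bx, y⟩ : x ∈ K ∩ B^ℓ, y ∈ K' ∩ B^p }`. -/
def resNormGen {l p : ℕ} (K : Set (Euc l)) (K' : Set (Euc p))
    (B : Matrix (Fin p) (Fin l) ℝ) : ℝ :=
  sSup (Set.image2 (fun x y => ⟪mulE B x, y⟫_ℝ) (K ∩ closedBall 0 1) (K' ∩ closedBall 0 1))

/-- The operator (spectral) norm of a matrix. -/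
def opNorm {m n : ℕ} (A : Matrix (Fin n) (Fin m) ℝ) : ℝ :=
  ‖LinearMap.toContinuousLinearMap (Matrix.toEuclideanLin A)‖

/-- The standard Gaussian measure on `ℝ^k` (i.i.d. N(0,1) coordinates). -/
def stdGaussianE (k : ℕ) : Measure (Euc k) :=
  Measure.map (⇑(EuclideanSpace.equiv (Fin k) ℝ).symm)
    (Measure.pi fun _ : Fin k => gaussianReal 0 1)

/-- The standard Gaussian measure on `n × m` arrays (i.i.d. N(0,1) entries). -/
def stdGaussianPi (n m : ℕ) : Measure (Fin n → Fin m → ℝ) :=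
  Measure.pi fun _ : Fin n => Measure.pi fun _ : Fin m => gaussianReal 0 1

/-- The support function `h_K(x) = sup_{z ∈ K} ⟨x, z⟩`. -/
def suppFn {k : ℕ} (K : Set (Euc k)) (x : Euc k) : ℝ := sSup ((fun z => ⟪x, z⟫_ℝ) '' K)

/-- The capped-angle cosine `cos d̄(X,Y) = max{⟨x,y⟩ : x ∈ X ∩ B, y ∈ Y ∩ B}`. -/
def cosAng {k : ℕ} (X Y : Set (Euc k)) : ℝ :=
  sSup (Set.image2 (fun x y => ⟪x, y⟫_ℝ) (X ∩ closedBall 0 1) (Y ∩ closedBall 0 1))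

/-- `sin d̄(X,Y) = √(1 - cos d̄(X,Y)²)`. -/
def sinAng {k : ℕ} (X Y : Set (Euc k)) : ℝ := Real.sqrt (1 - cosAng X Y ^ 2)

/-- The Kronecker (tensor) product `x ⊗ y ∈ ℝ^{mn}`. -/
def kron {m n : ℕ} (x : Euc m) (y : Euc n) : EuclideanSpace ℝ (Fin m × Fin n) :=
  (EuclideanSpace.equiv (Fin m × Fin n) ℝ).symm (fun p => x p.1 * y p.2)

/-- The primal feasible set `𝒫(C,D) = {A | ∃ x ∈ C \ {0}, Ax ∈ D°}`. -/
def primalSet {m n : ℕ} (C : Set (Euc m)) (D : Set (Euc n)) :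
    Set (Matrix (Fin n) (Fin m) ℝ) :=
  {A | ∃ x ∈ C, x ≠ 0 ∧ mulE A x ∈ polarCone D}

/-- The dual feasible set `𝒟(C,D) = {A | ∃ y ∈ D \ {0}, -Aᵀy ∈ C°}`. -/
def dualSet {m n : ℕ} (C : Set (Euc m)) (D : Set (Euc n)) :
    Set (Matrix (Fin n) (Fin m) ℝ) :=
  {A | ∃ y ∈ D, y ≠ 0 ∧ -(mulE A.transpose y) ∈ polarCone C}

/-- `K₂` is a `0`-contraction of `K₁`: there are generating sets `M₁` of `K₁`, `M₂` of `K₂`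
(i.e. `Kᵢ` is the closed convex hull of `Mᵢ`) and a surjection `φ : M₁ → M₂` that is
`1`-Lipschitz and norm-nonincreasing. -/
def IsZeroContractionOf {E₁ E₂ : Type*} [NormedAddCommGroup E₁] [NormedSpace ℝ E₁]
    [NormedAddCommGroup E₂] [NormedSpace ℝ E₂] (K₁ : Set E₁) (K₂ : Set E₂) : Prop :=
  ∃ (M₁ : Set E₁) (M₂ : Set E₂) (φ : E₁ → E₂),
    closure (convexHull ℝ M₁) = K₁ ∧ closure (convexHull ℝ M₂) = K₂ ∧
    φ '' M₁ = M₂ ∧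
    (∀ x ∈ M₁, ∀ x' ∈ M₁, ‖φ x - φ x'‖ ≤ ‖x - x'‖) ∧
    (∀ x ∈ M₁, ‖φ x‖ ≤ ‖x‖)

/-- The pair `(x, y)` regarded as an element of the Euclidean (ℓ²) product. -/
def pairL2 {m n : ℕ} (x : Euc m) (y : Euc n) : WithLp 2 (Euc m × Euc n) :=
  (WithLp.equiv 2 (Euc m × Euc n)).symm (x, y)

/-- The product `K × K'` as a subset of the Euclidean (ℓ²) product space. -/
def prodL2 {m n : ℕ} (K : Set (Euc m)) (K' : Set (Euc n)) : Set (WithLp 2 (Euc m × Euc n)) :=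
  {q | ((WithLp.equiv 2 (Euc m × Euc n)) q).1 ∈ K ∧ ((WithLp.equiv 2 (Euc m × Euc n)) q).2 ∈ K'}



section GaussianInterpolation

variable {I : Type*} [Fintype I]

/-- `H` is a bounded function on `ℝ^I` whose partial derivatives `H' b` are bounded and
continuous. -/
structure HasBddPartials (H : (I → ℝ) → ℝ) (H' : I → (I → ℝ) → ℝ) : Prop where
  bdd : ∃ K, ∀ z, ‖H z‖ ≤ K
  bdd' : ∀ b, ∃ K, ∀ z, ‖H' b z‖ ≤ K
  cont' : ∀ b, Continuous (H' b)
  hasFDerivAt : ∀ z, HasFDerivAt H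
    (∑ b, H' b z • (ContinuousLinearMap.proj b : (I → ℝ) →L[ℝ] ℝ)) z

namespace HasBddPartials

variable {H : (I → ℝ) → ℝ} {H' : I → (I → ℝ) → ℝ}

theorem continuous (h : HasBddPartials H H') : Continuous H :=
  continuous_iff_continuousAt.2 fun z => (h.hasFDerivAt z).continuousAt

theorem hasDerivAt_comp (h : HasBddPartials H H') {u : ℝ → I → ℝ} {u' : I → ℝ} {s : ℝ}
    (hu : ∀ b, HasDerivAt (fun r => u r b) (u' b) s) :
    HasDerivAt (fun r => H (u r)) (∑ b, H' b (u s) * u' b) s := by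
  have h1 := (h.hasFDerivAt (u s)).comp_hasDerivAt s (hasDerivAt_pi.2 hu)
  exact h1.congr_deriv (by simp)

theorem comp_smul_add (h : HasBddPartials H H') (c : ℝ) (v : I → ℝ) :
    HasBddPartials (fun z => H (c • z + v)) (fun b z => c * H' b (c • z + v)) where
  bdd := let ⟨K, hK⟩ := h.bdd; ⟨K, fun z => hK _⟩
  bdd' b := by
    obtain ⟨K, hK⟩ := h.bdd' b
    refine ⟨‖c‖ * K, fun z => ?_⟩
    rw [norm_mul]
    gcongr
    exact hK _
  cont' b := by
    have := h.cont' b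
    fun_prop
  hasFDerivAt z := by
    have h1 : HasFDerivAt (fun z : I → ℝ => c • z + v)
        (c • ContinuousLinearMap.id ℝ (I → ℝ)) z :=
      ((hasFDerivAt_id z).const_smul c).add_const v
    refine ((h.hasFDerivAt (c • z + v)).comp z h1).congr_fderiv ?_
    ext w
    simp [Finset.mul_sum, mul_comm, mul_left_comm]

end HasBddPartials

variable {Ω Ω' : Type*} [MeasurableSpace Ω] [MeasurableSpace Ω']

/-- The random vector `A` satisfies the Gaussian integration by parts formula with
covariance matrix `S`. -/
structure GaussianIBP (μ : Measure Ω) (A : Ω → I → ℝ) (S : I → I → ℝ) : Prop where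
  measurable : Measurable A
  integrable : ∀ a, Integrable (fun w => A w a) μ
  ibp : ∀ (H : (I → ℝ) → ℝ) (H' : I → (I → ℝ) → ℝ), HasBddPartials H H' → ∀ a,
    ∫ w, A w a * H (A w) ∂μ = ∑ b, S a b * ∫ w, H' b (A w) ∂μ

namespace GaussianIBP

variable {μ : Measure Ω} {ν : Measure Ω'}
  {A : Ω → I → ℝ} {B : Ω' → I → ℝ} {S T : I → I → ℝ}
  {H : (I → ℝ) → ℝ} {H' : I → (I → ℝ) → ℝ}

theorem integrable_mul_comp {X : Ω → ℝ} {Z : Ω → I → ℝ} (hX : Integrable X μ)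
    (hZ : Measurable Z) {G : (I → ℝ) → ℝ} (hG : Continuous G) (hb : ∃ K, ∀ z, ‖G z‖ ≤ K) :
    Integrable (fun w => X w * G (Z w)) μ := by
  obtain ⟨K, hK⟩ := hb
  exact hX.mul_bdd (c := K) (hG.measurable.comp hZ).aestronglyMeasurable (ae_of_all _ fun w => hK _)

theorem integrable_comp [IsFiniteMeasure μ] {Z : Ω → I → ℝ}
    (hZ : Measurable Z) {G : (I → ℝ) → ℝ} (hG : Continuous G) (hb : ∃ K, ∀ z, ‖G z‖ ≤ K) :
    Integrable (fun w => G (Z w)) μ := by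
  obtain ⟨K, hK⟩ := hb
  exact Integrable.of_bound (hG.measurable.comp hZ).aestronglyMeasurable K
    (ae_of_all _ fun w => hK _)

theorem ibp_smul_add (hA : GaussianIBP μ A S) (hH : HasBddPartials H H') (c : ℝ) (v : I → ℝ)
    (a : I) : ∫ w, A w a * H (c • A w + v) ∂μ
      = ∑ b, S a b * (c * ∫ w, H' b (c • A w + v) ∂μ) := by
  rw [hA.ibp _ _ (hH.comp_smul_add c v) a]
  simp [integral_const_mul]

theorem measurable_smul_add (hA : GaussianIBP μ A S) (hB : GaussianIBP ν B T) (c d : ℝ) :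
    Measurable (fun p : Ω × Ω' => c • A p.1 + d • B p.2) :=
  ((hA.measurable.comp measurable_fst).const_smul c).add
    ((hB.measurable.comp measurable_snd).const_smul d)

theorem comp_measurePreserving (hA : GaussianIBP μ A S) {e : Ω' → Ω}
    (he : MeasurePreserving e ν μ) : GaussianIBP ν (fun w => A (e w)) S where
  measurable := hA.measurable.comp he.measurable
  integrable a := he.integrable_comp_of_integrable (hA.integrable a)
  ibp H H' hH a := by
    have hc : ∀ {G : (I → ℝ) → ℝ}, Continuous G →
        AEStronglyMeasurable (fun w => G (A w)) (ν.map e) := fun hG =>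
      (hG.measurable.comp hA.measurable).aestronglyMeasurable
    have h := hA.ibp H H' hH a
    rw [← he.map_eq] at h
    rw [integral_map he.measurable.aemeasurable
      (hc (G := fun z => z a * H z) ((continuous_apply a).mul hH.continuous))] at h
    simp_rw [integral_map he.measurable.aemeasurable (hc (hH.cont' _))] at h
    exact h

variable [IsProbabilityMeasure μ] [IsProbabilityMeasure ν]

theorem ibp_prod_left (hA : GaussianIBP μ A S) (hB : GaussianIBP ν B T)
    (hH : HasBddPartials H H') (c d : ℝ) (a : I) :
    ∫ p, A p.1 a * H (c • A p.1 + d • B p.2) ∂(μ.prod ν)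
      = c * ∑ b, S a b * ∫ p, H' b (c • A p.1 + d • B p.2) ∂(μ.prod ν) := by
  have hm := hA.measurable_smul_add hB c d
  have hi : ∀ b, Integrable (fun p : Ω × Ω' => H' b (c • A p.1 + d • B p.2)) (μ.prod ν) :=
    fun b => integrable_comp hm (hH.cont' b) (hH.bdd' b)
  rw [integral_prod_symm _ (integrable_mul_comp ((hA.integrable a).comp_fst ν) hm
    hH.continuous hH.bdd)]
  simp_rw [hA.ibp_smul_add hH c]
  rw [integral_finsetSum _ fun b _ => ((hi b).integral_prod_right.const_mul c).const_mul _,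
    Finset.mul_sum]
  refine Finset.sum_congr rfl fun b _ => ?_
  rw [integral_const_mul, integral_const_mul, integral_prod_symm _ (hi b)]
  ring

theorem ibp_prod_right (hA : GaussianIBP μ A S) (hB : GaussianIBP ν B T)
    (hH : HasBddPartials H H') (c d : ℝ) (a : I) :
    ∫ p, B p.2 a * H (c • A p.1 + d • B p.2) ∂(μ.prod ν)
      = d * ∑ b, T a b * ∫ p, H' b (c • A p.1 + d • B p.2) ∂(μ.prod ν) := by
  have h := ibp_prod_left hB hA hH d c a
  rw [← integral_prod_swap]
  simp_rw [← integral_prod_swap (μ := μ) (ν := ν)]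
  simpa [add_comm] using h

theorem prod_add (hA : GaussianIBP μ A S) (hB : GaussianIBP ν B T) :
    GaussianIBP (μ.prod ν) (fun p => A p.1 + B p.2) (fun a b => S a b + T a b) where
  measurable := (hA.measurable.comp measurable_fst).add (hB.measurable.comp measurable_snd)
  integrable a := ((hA.integrable a).comp_fst ν).add ((hB.integrable a).comp_snd μ)
  ibp H H' hH a := by
    have h1 := hA.ibp_prod_left hB hH 1 1 a
    have h2 := hA.ibp_prod_right hB hH 1 1 a
    have hm := hA.measurable_smul_add hB 1 1
    have i1 := integrable_mul_comp ((hA.integrable a).comp_fst ν) hm hH.continuous hH.bdd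
    have i2 := integrable_mul_comp ((hB.integrable a).comp_snd μ) hm hH.continuous hH.bdd
    simp only [one_smul, one_mul] at h1 h2 i1 i2
    simp only [Pi.add_apply, add_mul, Finset.sum_add_distrib]
    rw [integral_add i1 i2, h1, h2]

theorem zero : GaussianIBP μ (fun _ => (0 : I → ℝ)) (fun _ _ => 0) where
  measurable := measurable_const
  integrable a := by simp
  ibp H H' hH a := by simp

theorem pi {k : ℕ} {X : Type*} [MeasurableSpace X] {ρ : Measure X} [IsProbabilityMeasure ρ]
    {A : Fin k → X → I → ℝ} {S : Fin k → I → I → ℝ} (h : ∀ i, GaussianIBP ρ (A i) (S i)) :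
    GaussianIBP (Measure.pi fun _ : Fin k => ρ) (fun w => ∑ i, A i (w i))
      (fun a b => ∑ i, S i a b) := by
  induction k with
  | zero => simpa using zero
  | succ k ih =>
    have h1 := ((h 0).prod_add (ih fun i => h i.succ)).comp_measurePreserving
      (measurePreserving_piFinSuccAbove (fun _ : Fin (k + 1) => ρ) 0)
    simpa [Fin.sum_univ_succ, MeasurableEquiv.piFinSuccAbove, Fin.tail] using h1

theorem integral_mul_gaussianReal {h h' : ℝ → ℝ} (hd : ∀ x, HasDerivAt h (h' x) x)
    (hb : ∃ K, ∀ x, ‖h x‖ ≤ K) (hb' : ∃ K, ∀ x, ‖h' x‖ ≤ K) (hc' : Continuous h') :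
    ∫ x, x * h x ∂(gaussianReal 0 1) = ∫ x, h' x ∂(gaussianReal 0 1) := by
  have hc : Continuous h := continuous_iff_continuousAt.2 fun x => (hd x).continuousAt
  obtain ⟨K, hK⟩ := hb
  obtain ⟨K', hK'⟩ := hb'
  have hpdf : ∀ x, HasDerivAt (gaussianPDFReal 0 1) (-x * gaussianPDFReal 0 1 x) x := by
    intro x
    have h1 : HasDerivAt (fun x : ℝ => -(x - 0) ^ 2 / (2 * ((1 : NNReal) : ℝ))) (-x) x := by
      have := (((hasDerivAt_id x).sub_const 0).pow 2).neg.div_const (2 * ((1 : NNReal) : ℝ))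
      refine this.congr_deriv ?_
      simp
      ring
    have := h1.exp.const_mul (Real.sqrt (2 * Real.pi * ((1 : NNReal) : ℝ)))⁻¹
    refine this.congr_deriv ?_
    simp only [gaussianPDFReal]
    ring
  have hid : Integrable (fun x : ℝ => x) (gaussianReal 0 1) :=
    (memLp_id_gaussianReal (μ := 0) (v := 1) 1).integrable le_rfl
  have hx : Integrable (fun x : ℝ => gaussianPDFReal 0 1 x * x) := by
    rw [gaussianReal_of_var_ne_zero _ one_ne_zero,
      integrable_withDensity_iff_integrable_smul' (measurable_gaussianPDF 0 1)
        (ae_of_all _ fun _ => gaussianPDF_lt_top)] at hid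
    simpa [toReal_gaussianPDF] using hid
  have hp := integrable_gaussianPDFReal 0 1
  have key := integral_mul_deriv_eq_deriv_mul_of_integrable (u := h) (u' := h')
    (v := gaussianPDFReal 0 1) (v' := fun x => -x * gaussianPDFReal 0 1 x)
    (fun x _ => hd x) (fun x _ => hpdf x)
    ((hx.neg.bdd_mul (c := K) hc.aestronglyMeasurable (ae_of_all _ hK)).congr
      (ae_of_all _ fun x => by simp only [Pi.neg_apply, Pi.mul_apply]; ring))
    (hp.bdd_mul (c := K') hc'.aestronglyMeasurable (ae_of_all _ hK'))
    (hp.bdd_mul (c := K) hc.aestronglyMeasurable (ae_of_all _ hK))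
  rw [integral_gaussianReal_eq_integral_smul one_ne_zero,
    integral_gaussianReal_eq_integral_smul one_ne_zero]
  simp only [smul_eq_mul]
  rw [← neg_inj, ← integral_neg]
  simp_rw [mul_comm (gaussianPDFReal 0 1 _) (h' _)]
  rw [← key]
  congr 1 with x
  ring

theorem gaussianReal (v : I → ℝ) :
    GaussianIBP (gaussianReal 0 1) (fun x => x • v) (fun a b => v a * v b) where
  measurable := by fun_prop
  integrable a := by
    have hid : Integrable (fun x : ℝ => x) (ProbabilityTheory.gaussianReal 0 1) :=
      (memLp_id_gaussianReal (μ := 0) (v := 1) 1).integrable le_rfl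
    simpa using hid.mul_const (v a)
  ibp H H' hH a := by
    have hc : ∀ b, Continuous fun x : ℝ => H' b (x • v) := fun b => by
      have := hH.cont' b
      fun_prop
    have hd : ∀ x, HasDerivAt (fun x : ℝ => H (x • v)) (∑ b, H' b (x • v) * v b) x := fun x =>
      hH.hasDerivAt_comp (u := fun r => r • v) fun b => by
        simpa using (hasDerivAt_id x).mul_const (v b)
    choose K hK using hH.bdd'
    have key := integral_mul_gaussianReal hd
      (let ⟨K, hK⟩ := hH.bdd; ⟨K, fun x => hK _⟩)
      ⟨∑ b, K b * ‖v b‖, fun x => (norm_sum_le _ _).trans (Finset.sum_le_sum fun b _ => by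
        rw [norm_mul]; gcongr; exact hK b _)⟩
      (continuous_finsetSum _ fun b _ => (hc b).mul continuous_const)
    have hl : ∀ x : ℝ, (x • v) a * H (x • v) = v a * (x * H (x • v)) := fun x => by
      simp; ring
    simp_rw [hl]
    rw [integral_const_mul, key, integral_finsetSum, Finset.mul_sum]
    · refine Finset.sum_congr rfl fun b _ => ?_
      rw [integral_mul_const]
      ring
    · exact fun b _ => (integrable_comp (Z := fun x : ℝ => x • v) (by fun_prop)
        (hH.cont' b) (hH.bdd' b)).mul_const _

/-- **Gaussian interpolation**: if `F` has nonnegative second derivative in the direction of the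
difference `S - T` of the covariances, its expectation is larger under `S` than under `T`. -/
theorem integral_le_integral (hA : GaussianIBP μ A S) (hB : GaussianIBP ν B T)
    {F : (I → ℝ) → ℝ} {F₁ : I → (I → ℝ) → ℝ} {F₂ : I → I → (I → ℝ) → ℝ}
    (hF : HasBddPartials F F₁) (hF₁ : ∀ a, HasBddPartials (F₁ a) (F₂ a))
    (hsign : ∀ a b z, 0 ≤ (S a b - T a b) * F₂ a b z) :
    ∫ w, F (B w) ∂ν ≤ ∫ w, F (A w) ∂μ := by
  set Z : ℝ → Ω × Ω' → I → ℝ := fun s p => Real.cos s • A p.1 + Real.sin s • B p.2 with hZ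
  have hZm : ∀ s, Measurable (Z s) := fun s => hA.measurable_smul_add hB _ _
  set ψ : ℝ → ℝ := fun s => ∫ p, F (Z s p) ∂(μ.prod ν) with hψ
  choose K hK using fun a => (hF₁ a).bdd
  have hK0 : ∀ a, 0 ≤ K a := fun a => (norm_nonneg _).trans (hK a 0)
  have hAi : ∀ a, Integrable (fun p : Ω × Ω' => A p.1 a) (μ.prod ν) :=
    fun a => (hA.integrable a).comp_fst ν
  have hBi : ∀ a, Integrable (fun p : Ω × Ω' => B p.2 a) (μ.prod ν) :=
    fun a => (hB.integrable a).comp_snd μ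
  have hFi : ∀ s, Integrable (fun p => F (Z s p)) (μ.prod ν) :=
    fun s => integrable_comp (hZm s) hF.continuous hF.bdd
  have hiA : ∀ s a, Integrable (fun p => A p.1 a * F₁ a (Z s p)) (μ.prod ν) := fun s a =>
    integrable_mul_comp (hAi a) (hZm s) (hF₁ a).continuous (hF₁ a).bdd
  have hiB : ∀ s a, Integrable (fun p => B p.2 a * F₁ a (Z s p)) (μ.prod ν) := fun s a =>
    integrable_mul_comp (hBi a) (hZm s) (hF₁ a).continuous (hF₁ a).bdd
  set Z' : ℝ → Ω × Ω' → ℝ := fun s p => ∑ a, (-Real.sin s * (A p.1 a * F₁ a (Z s p))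
    + Real.cos s * (B p.2 a * F₁ a (Z s p))) with hZ'
  have hi' : ∀ s a, Integrable (fun p => -Real.sin s * (A p.1 a * F₁ a (Z s p))
      + Real.cos s * (B p.2 a * F₁ a (Z s p))) (μ.prod ν) := fun s a =>
    ((hiA s a).const_mul _).add ((hiB s a).const_mul _)
  have hderiv : ∀ s, HasDerivAt ψ (∫ p, Z' s p ∂(μ.prod ν)) s := by
    intro s
    refine (hasDerivAt_integral_of_dominated_loc_of_deriv_le (s := univ)
      (bound := fun p => ∑ a, (‖A p.1 a‖ * K a + ‖B p.2 a‖ * K a)) Filter.univ_mem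
      (Filter.Eventually.of_forall fun r => (hFi r).aestronglyMeasurable) (hFi s)
      (integrable_finsetSum _ fun a _ => hi' s a).aestronglyMeasurable
      (ae_of_all _ fun p r _ => ?_)
      (integrable_finsetSum _ fun a _ =>
        ((hAi a).norm.mul_const _).add ((hBi a).norm.mul_const _))
      (ae_of_all _ fun p r _ => ?_)).2
    · refine (norm_sum_le _ _).trans (Finset.sum_le_sum fun a _ => (norm_add_le _ _).trans ?_)
      simp only [norm_mul, norm_neg]
      have h1 : ‖Real.sin r‖ ≤ 1 := Real.abs_sin_le_one r
      have h2 : ‖Real.cos r‖ ≤ 1 := Real.abs_cos_le_one r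
      have h3 : ‖A p.1 a‖ * ‖F₁ a (Z r p)‖ ≤ ‖A p.1 a‖ * K a := by
        gcongr; exact hK a _
      have h4 : ‖B p.2 a‖ * ‖F₁ a (Z r p)‖ ≤ ‖B p.2 a‖ * K a := by
        gcongr; exact hK a _
      exact add_le_add ((mul_le_of_le_one_left (by positivity) h1).trans h3)
        ((mul_le_of_le_one_left (by positivity) h2).trans h4)
    · have := hF.hasDerivAt_comp (u := fun r => Z r p)
        (u' := fun b => -Real.sin r * A p.1 b + Real.cos r * B p.2 b) (s := r) fun b =>
          ((Real.hasDerivAt_cos r).mul_const (A p.1 b)).add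
            ((Real.hasDerivAt_sin r).mul_const (B p.2 b))
      refine this.congr_deriv (Finset.sum_congr rfl fun b _ => ?_)
      ring
  have hneg : ∀ s, 0 ≤ Real.sin s → 0 ≤ Real.cos s → ∫ p, Z' s p ∂(μ.prod ν) ≤ 0 := by
    intro s hs hc
    have heq : ∫ p, Z' s p ∂(μ.prod ν) = -(Real.sin s * Real.cos s *
        ∑ a, ∑ b, (S a b - T a b) * ∫ p, F₂ a b (Z s p) ∂(μ.prod ν)) := by
      rw [integral_finsetSum _ fun a _ => hi' s a, Finset.mul_sum, ← Finset.sum_neg_distrib]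
      refine Finset.sum_congr rfl fun a _ => ?_
      rw [integral_add ((hiA s a).const_mul _) ((hiB s a).const_mul _), integral_const_mul,
        integral_const_mul, hA.ibp_prod_left hB (hF₁ a), hA.ibp_prod_right hB (hF₁ a)]
      simp only [sub_mul, Finset.sum_sub_distrib]
      ring
    rw [heq, neg_nonpos]
    refine mul_nonneg (mul_nonneg hs hc) (Finset.sum_nonneg fun a _ =>
      Finset.sum_nonneg fun b _ => ?_)
    rw [← integral_const_mul]
    exact integral_nonneg fun p => hsign a b _
  have hanti : AntitoneOn ψ (Icc 0 (Real.pi / 2)) := by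
    refine antitoneOn_of_deriv_nonpos (convex_Icc _ _)
      (fun s _ => (hderiv s).continuousAt.continuousWithinAt)
      (fun s _ => (hderiv s).differentiableAt.differentiableWithinAt) fun s hs => ?_
    rw [interior_Icc] at hs
    rw [(hderiv s).deriv]
    exact hneg s (Real.sin_nonneg_of_nonneg_of_le_pi hs.1.le (by linarith [hs.2, Real.pi_pos]))
      (Real.cos_nonneg_of_neg_pi_div_two_le_of_le (by linarith [hs.1, Real.pi_pos]) hs.2.le)
  have h := hanti (left_mem_Icc.2 (by positivity)) (right_mem_Icc.2 (by positivity))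
    (by positivity)
  have h0 : ψ 0 = ∫ w, F (A w) ∂μ := by
    simp only [hψ, hZ, Real.cos_zero, Real.sin_zero, one_smul, zero_smul, add_zero]
    simpa using integral_fun_fst (μ := μ) (ν := ν) (fun w => F (A w))
  have h1 : ψ (Real.pi / 2) = ∫ w, F (B w) ∂ν := by
    simp only [hψ, hZ, Real.cos_pi_div_two, Real.sin_pi_div_two, one_smul, zero_smul, zero_add]
    simpa using integral_fun_snd (μ := μ) (ν := ν) (fun w => F (B w))
  rwa [h0, h1] at h

end GaussianIBP

end GaussianInterpolation

section GordonPolynomial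

open MvPolynomial

variable {I : Type*}

/-- The polynomial `p` evaluated at the coordinatewise sigmoids of slope `c` centred at `t`. -/
def sigmoidEval (c t : ℝ) (p : MvPolynomial I ℝ) (z : I → ℝ) : ℝ :=
  eval (fun a => Real.sigmoid (c * (z a - t))) p

/-- The polynomial representing the partial derivative of `sigmoidEval c t p`. -/
def sigmoidPartial (c : ℝ) (a : I) (p : MvPolynomial I ℝ) : MvPolynomial I ℝ :=
  C c * X a * (1 - X a) * pderiv a p

theorem continuous_sigmoidEval (c t : ℝ) (p : MvPolynomial I ℝ) :
    Continuous (sigmoidEval c t p) := by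
  refine (continuous_eval p).comp (continuous_pi fun a => ?_)
  have := _root_.continuous_sigmoid
  fun_prop

theorem exists_norm_sigmoidEval_le (c t : ℝ) (p : MvPolynomial I ℝ) :
    ∃ K, ∀ z, ‖sigmoidEval c t p z‖ ≤ K := by
  obtain ⟨K, hK⟩ := (isCompact_univ_pi fun _ : I => isCompact_Icc (a := (0 : ℝ))
    (b := 1)).exists_bound_of_continuousOn (continuous_eval p).continuousOn
  exact ⟨K, fun z => hK _ fun a _ => ⟨Real.sigmoid_nonneg _, Real.sigmoid_le_one _⟩⟩

theorem hasBddPartials_sigmoidEval [Fintype I] (c t : ℝ) (p : MvPolynomial I ℝ) :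
    HasBddPartials (sigmoidEval c t p) (fun b => sigmoidEval c t (sigmoidPartial c b p)) where
  bdd := exists_norm_sigmoidEval_le c t p
  bdd' b := exists_norm_sigmoidEval_le c t _
  cont' b := continuous_sigmoidEval c t _
  hasFDerivAt z := by
    induction p using MvPolynomial.induction_on with
    | C r =>
      have hF : sigmoidEval c t (C r) = fun _ : I → ℝ => r := by
        ext z
        simp [sigmoidEval]
      rw [hF]
      refine (hasFDerivAt_const (𝕜 := ℝ) r z).congr_fderiv ?_
      simp [sigmoidEval, sigmoidPartial]
    | add p q hp hq =>
      have hF : sigmoidEval c t (p + q) = sigmoidEval c t p + sigmoidEval c t q := by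
        ext z
        simp [sigmoidEval]
      rw [hF]
      refine (hp.add hq).congr_fderiv ?_
      simp [sigmoidEval, sigmoidPartial, mul_add, add_smul, Finset.sum_add_distrib]
    | mul_X p a hp =>
      have h1 : HasDerivAt (fun u : ℝ => Real.sigmoid (c * (u - t)))
          (Real.sigmoid (c * (z a - t)) * (1 - Real.sigmoid (c * (z a - t))) * c) (z a) := by
        have h2 : HasDerivAt (fun u : ℝ => c * (u - t)) c (z a) := by
          simpa using ((hasDerivAt_id (z a)).sub_const t).const_mul c
        exact (Real.hasDerivAt_sigmoid _).comp (z a) h2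
      have h3 := h1.comp_hasFDerivAt z
        (ContinuousLinearMap.proj a : (I → ℝ) →L[ℝ] ℝ).hasFDerivAt
      have h := hp.mul h3
      have hF : sigmoidEval c t (p * X a) = sigmoidEval c t p *
          ((fun u : ℝ => Real.sigmoid (c * (u - t))) ∘
            (ContinuousLinearMap.proj a : (I → ℝ) →L[ℝ] ℝ)) := by
        ext z
        simp [sigmoidEval]
      rw [hF]
      refine h.congr_fderiv ?_
      ext v
      simp only [sigmoidEval, sigmoidPartial, pderiv_mul, pderiv_X, Pi.single_apply]
      simp [Finset.mul_sum, mul_add, add_mul, Finset.sum_add_distrib]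
      rw [add_comm]
      congr 1
      · exact Finset.sum_congr rfl fun b _ => by ring
      · rw [Finset.sum_eq_single a (fun b _ hb => by simp [hb.symm]) (by simp)]
        simp
        ring

variable {ι J : Type*} [Fintype J]

/-- The factor `1 - ∏ j, (1 - X (i, j))` detecting that some entry of row `i` is on. -/
def rowPoly (J : Type*) [Fintype J] (i : ι) : MvPolynomial (ι × J) ℝ :=
  1 - ∏ j, (1 - X (i, j))

/-- The partial derivative of `rowPoly` in the variable `a` of that row. -/
def rowPartial (a : ι × J) : MvPolynomial (ι × J) ℝ :=
  ∏ j ∈ Finset.univ.erase a.2, (1 - X (a.1, j))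

theorem pderiv_prod_eq_zero {σ α : Type*} {s : Finset α} {f : α → MvPolynomial σ ℝ} {b : σ}
    (h : ∀ x ∈ s, pderiv b (f x) = 0) : pderiv b (∏ x ∈ s, f x) = 0 :=
  Finset.prod_induction f (fun q => pderiv b q = 0)
    (fun p q hp hq => by simp [hp, hq]) (by simp) h

theorem pderiv_one_sub_X_of_ne {σ : Type*} {a b : σ} (h : a ≠ b) :
    pderiv b (1 - X a : MvPolynomial σ ℝ) = 0 := by
  simp [pderiv_X_of_ne h]

theorem pderiv_rowPoly_of_ne {i : ι} {b : ι × J} (h : i ≠ b.1) :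
    pderiv b (rowPoly J i) = 0 := by
  rw [rowPoly, map_sub, pderiv_one, pderiv_prod_eq_zero, sub_zero]
  exact fun j _ => pderiv_one_sub_X_of_ne fun hj => h (hj ▸ rfl)

theorem pderiv_rowPartial_of_ne {a b : ι × J} (h : a.1 ≠ b.1) :
    pderiv b (rowPartial a) = 0 :=
  pderiv_prod_eq_zero fun _ _ => pderiv_one_sub_X_of_ne fun hj => h (hj ▸ rfl)

theorem pderiv_rowPoly_self (a : ι × J) : pderiv a (rowPoly J a.1) = rowPartial a := by
  have h0 : pderiv a (rowPartial a) = 0 := pderiv_prod_eq_zero fun j hj =>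
    pderiv_one_sub_X_of_ne fun h => Finset.ne_of_mem_erase hj (h ▸ rfl)
  rw [rowPoly, ← Finset.mul_prod_erase _ _ (Finset.mem_univ a.2)]
  change pderiv a (1 - (1 - X a) * rowPartial a) = _
  simp [h0]

variable {u : ι × J → ℝ}

theorem eval_rowPoly (u : ι × J → ℝ) (i : ι) :
    eval u (rowPoly J i) = 1 - ∏ j, (1 - u (i, j)) := by
  simp [rowPoly, map_prod]

theorem eval_rowPoly_mem_Icc (hu : ∀ a, u a ∈ Icc (0 : ℝ) 1) (i : ι) :
    eval u (rowPoly J i) ∈ Icc (0 : ℝ) 1 := by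
  rw [eval_rowPoly]
  have h1 : ∏ j, (1 - u (i, j)) ≤ 1 := Finset.prod_le_one
    (fun j _ => by linarith [(hu (i, j)).2]) (fun j _ => by linarith [(hu (i, j)).1])
  have h2 : 0 ≤ ∏ j, (1 - u (i, j)) := Finset.prod_nonneg
    fun j _ => by linarith [(hu (i, j)).2]
  exact ⟨by linarith, by linarith⟩

theorem eval_rowPartial_nonneg (hu : ∀ a, u a ∈ Icc (0 : ℝ) 1) (a : ι × J) :
    0 ≤ eval u (rowPartial a) := by
  rw [rowPartial, map_prod]
  exact Finset.prod_nonneg fun j _ => by simpa using (hu (a.1, j)).2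

variable [Fintype ι]

/-- The polynomial `∏ i, (1 - ∏ j, (1 - X (i, j)))`. -/
def gordonPoly (ι J : Type*) [Fintype ι] [Fintype J] : MvPolynomial (ι × J) ℝ :=
  ∏ i, rowPoly J i

theorem pderiv_gordonPoly (a : ι × J) : pderiv a (gordonPoly ι J)
    = rowPartial a * ∏ i ∈ Finset.univ.erase a.1, rowPoly J i := by
  have h0 : pderiv a (∏ i ∈ Finset.univ.erase a.1, rowPoly J i) = 0 :=
    pderiv_prod_eq_zero fun i hi => pderiv_rowPoly_of_ne (Finset.ne_of_mem_erase hi)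
  rw [gordonPoly, ← Finset.mul_prod_erase _ _ (Finset.mem_univ a.1), pderiv_mul, h0,
    pderiv_rowPoly_self, mul_zero, add_zero]

theorem pderiv_pderiv_gordonPoly {a b : ι × J} (h : a.1 ≠ b.1) :
    pderiv b (pderiv a (gordonPoly ι J)) = rowPartial a * (rowPartial b *
      ∏ i ∈ (Finset.univ.erase a.1).erase b.1, rowPoly J i) := by
  have h0 : pderiv b (∏ i ∈ (Finset.univ.erase a.1).erase b.1, rowPoly J i) = 0 :=
    pderiv_prod_eq_zero fun i hi => pderiv_rowPoly_of_ne (Finset.ne_of_mem_erase hi)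
  rw [pderiv_gordonPoly, ← Finset.mul_prod_erase _ _
    (Finset.mem_erase.2 ⟨h.symm, Finset.mem_univ b.1⟩), pderiv_mul, pderiv_mul, h0,
    pderiv_rowPoly_self, pderiv_rowPartial_of_ne h]
  simp

theorem eval_gordonPoly (u : ι × J → ℝ) :
    eval u (gordonPoly ι J) = ∏ i, (1 - ∏ j, (1 - u (i, j))) := by
  simp [gordonPoly, map_prod, eval_rowPoly]

theorem eval_gordonPoly_mem_Icc (hu : ∀ a, u a ∈ Icc (0 : ℝ) 1) :
    eval u (gordonPoly ι J) ∈ Icc (0 : ℝ) 1 := by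
  rw [gordonPoly, map_prod]
  exact ⟨Finset.prod_nonneg fun i _ => (eval_rowPoly_mem_Icc hu i).1,
    Finset.prod_le_one (fun i _ => (eval_rowPoly_mem_Icc hu i).1)
      fun i _ => (eval_rowPoly_mem_Icc hu i).2⟩

theorem sigmoidEval_partial_partial_nonneg (c t : ℝ) {a b : ι × J} (h : a.1 ≠ b.1)
    (z : ι × J → ℝ) :
    0 ≤ sigmoidEval c t (sigmoidPartial c b (sigmoidPartial c a (gordonPoly ι J))) z := by
  have hab : a ≠ b := fun h' => h (h' ▸ rfl)
  have hD : sigmoidPartial c b (sigmoidPartial c a (gordonPoly ι J))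
      = C c * C c * (X a * (1 - X a)) * (X b * (1 - X b)) *
        (rowPartial a * (rowPartial b *
          ∏ i ∈ (Finset.univ.erase a.1).erase b.1, rowPoly J i)) := by
    rw [← pderiv_pderiv_gordonPoly h, sigmoidPartial, sigmoidPartial, pderiv_mul (f := _ * _),
      pderiv_mul, pderiv_mul, pderiv_one_sub_X_of_ne hab, pderiv_X_of_ne hab, pderiv_C]
    ring
  rw [hD, sigmoidEval]
  set u : ι × J → ℝ := fun a => Real.sigmoid (c * (z a - t))
  have hu : ∀ a, u a ∈ Icc (0 : ℝ) 1 := fun a =>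
    ⟨Real.sigmoid_nonneg _, Real.sigmoid_le_one _⟩
  simp only [map_mul, map_sub, map_one, eval_C, eval_X, map_prod]
  have h1 : ∀ a, 0 ≤ u a * (1 - u a) := fun a =>
    mul_nonneg (hu a).1 (by linarith [(hu a).2])
  refine mul_nonneg (mul_nonneg (mul_nonneg (mul_self_nonneg c) (h1 a)) (h1 b))
    (mul_nonneg (eval_rowPartial_nonneg hu a) (mul_nonneg (eval_rowPartial_nonneg hu b)
      (Finset.prod_nonneg fun i _ => (eval_rowPoly_mem_Icc hu i).1)))

/-- The pointwise limit of the sigmoids `u ↦ sigmoid (c * (u - t))` as `c → ∞`. -/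
def stepLimit (t u : ℝ) : ℝ := if t < u then 1 else if t ≤ u then 2⁻¹ else 0

theorem stepLimit_mem_Icc (t u : ℝ) : stepLimit t u ∈ Icc (0 : ℝ) 1 := by
  unfold stepLimit
  split_ifs <;> norm_num

theorem measurable_stepLimit (t : ℝ) : Measurable (stepLimit t) :=
  Measurable.ite measurableSet_Ioi measurable_const
    (Measurable.ite measurableSet_Ici measurable_const measurable_const)

theorem tendsto_sigmoid_stepLimit (t u : ℝ) :
    Filter.Tendsto (fun k : ℕ => Real.sigmoid (k * (u - t))) Filter.atTop
      (nhds (stepLimit t u)) := by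
  have hk : Filter.Tendsto (fun k : ℕ => (k : ℝ)) Filter.atTop Filter.atTop :=
    tendsto_natCast_atTop_atTop
  unfold stepLimit
  split_ifs with h1 h2
  · exact Real.tendsto_sigmoid_atTop.comp (hk.atTop_mul_const (sub_pos.2 h1))
  · have : u = t := le_antisymm (not_lt.1 h1) h2
    simp [this]
  · exact Real.tendsto_sigmoid_atBot.comp
      (hk.atTop_mul_const_of_neg (sub_neg.2 (not_le.1 h2)))

theorem eval_stepLimit_eq_one {t : ℝ} {z : ι × J → ℝ} (h : ∀ i, ∃ j, t < z (i, j)) :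
    eval (fun a => stepLimit t (z a)) (gordonPoly ι J) = 1 := by
  rw [eval_gordonPoly]
  refine Finset.prod_eq_one fun i _ => ?_
  obtain ⟨j, hj⟩ := h i
  rw [Finset.prod_eq_zero (Finset.mem_univ j) (by simp [stepLimit, hj]), sub_zero]

theorem eval_stepLimit_eq_zero {t : ℝ} {z : ι × J → ℝ} (h : ¬ ∀ i, ∃ j, t ≤ z (i, j)) :
    eval (fun a => stepLimit t (z a)) (gordonPoly ι J) = 0 := by
  push Not at h
  obtain ⟨i, hi⟩ := h
  rw [eval_gordonPoly]
  refine Finset.prod_eq_zero (Finset.mem_univ i) ?_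
  rw [Finset.prod_eq_one fun j _ => ?_, sub_self]
  simp [stepLimit, (hi j).not_gt, (hi j).not_ge]

variable {Ω Ω' : Type*} [MeasurableSpace Ω] [MeasurableSpace Ω']
  {μ : Measure Ω} {ν : Measure Ω'} [IsProbabilityMeasure μ] [IsProbabilityMeasure ν]
  {A : Ω → ι × J → ℝ} {B : Ω' → ι × J → ℝ} {S T : ι × J → ι × J → ℝ}

theorem integrable_eval_stepLimit (hA : Measurable A) (t : ℝ) :
    Integrable (fun w => eval (fun a => stepLimit t (A w a)) (gordonPoly ι J)) μ := by
  refine Integrable.of_bound (C := 1) ?_ (ae_of_all _ fun w => ?_)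
  · exact ((continuous_eval _).measurable.comp (measurable_pi_lambda _ fun a =>
      (measurable_stepLimit t).comp ((measurable_pi_apply a).comp hA))).aestronglyMeasurable
  · have h := eval_gordonPoly_mem_Icc (u := fun a => stepLimit t (A w a))
      fun a => stepLimit_mem_Icc _ _
    rw [Real.norm_eq_abs, abs_le]
    exact ⟨neg_one_lt_zero.le.trans h.1, h.2⟩

theorem tendsto_integral_sigmoidEval (hA : Measurable A) (t : ℝ) :
    Filter.Tendsto (fun k : ℕ => ∫ w, sigmoidEval k t (gordonPoly ι J) (A w) ∂μ) Filter.atTop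
      (nhds (∫ w, eval (fun a => stepLimit t (A w a)) (gordonPoly ι J) ∂μ)) := by
  refine tendsto_integral_of_dominated_convergence (fun _ => 1)
    (fun k => ((continuous_sigmoidEval _ _ _).measurable.comp hA).aestronglyMeasurable)
    (integrable_const _) (fun k => ae_of_all _ fun w => ?_) (ae_of_all _ fun w => ?_)
  · have h := eval_gordonPoly_mem_Icc (u := fun a => Real.sigmoid (k * (A w a - t)))
      fun a => ⟨Real.sigmoid_nonneg _, Real.sigmoid_le_one _⟩
    rw [Real.norm_eq_abs, abs_le]
    exact ⟨neg_one_lt_zero.le.trans h.1, h.2⟩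
  · exact ((continuous_eval _).tendsto _).comp
      (tendsto_pi_nhds.2 fun a => tendsto_sigmoid_stepLimit t _)

/-- **Gordon's comparison inequality** for finite Gaussian matrices whose covariances agree
within each row. -/
theorem measure_gordon_le (hA : GaussianIBP μ A S) (hB : GaussianIBP ν B T)
    (heq : ∀ a b, a.1 = b.1 → S a b = T a b) (hle : ∀ a b, T a b ≤ S a b) (t : ℝ) :
    ν {w | ∀ i, ∃ j, t < B w (i, j)} ≤ μ {w | ∀ i, ∃ j, t ≤ A w (i, j)} := by
  have hlim : ∫ w, eval (fun a => stepLimit t (B w a)) (gordonPoly ι J) ∂ν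
      ≤ ∫ w, eval (fun a => stepLimit t (A w a)) (gordonPoly ι J) ∂μ := by
    refine le_of_tendsto_of_tendsto' (tendsto_integral_sigmoidEval hB.measurable t)
      (tendsto_integral_sigmoidEval hA.measurable t) fun k => ?_
    refine hA.integral_le_integral hB (hasBddPartials_sigmoidEval k t _)
      (fun a => hasBddPartials_sigmoidEval k t _) fun a b z => ?_
    by_cases h : a.1 = b.1
    · rw [heq a b h, sub_self, zero_mul]
    · exact mul_nonneg (sub_nonneg.2 (hle a b)) (sigmoidEval_partial_partial_nonneg _ _ h z)
  have hmB : MeasurableSet {w | ∀ i, ∃ j, t < B w (i, j)} := by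
    simp only [ofPred_forall, ofPred_exists]
    exact MeasurableSet.iInter fun i => MeasurableSet.iUnion fun j =>
      measurableSet_lt measurable_const ((measurable_pi_apply _).comp hB.measurable)
  have hmA : MeasurableSet {w | ∀ i, ∃ j, t ≤ A w (i, j)} := by
    simp only [ofPred_forall, ofPred_exists]
    exact MeasurableSet.iInter fun i => MeasurableSet.iUnion fun j =>
      measurableSet_le measurable_const ((measurable_pi_apply _).comp hA.measurable)
  refine (ENNReal.toReal_le_toReal (measure_ne_top _ _) (measure_ne_top _ _)).1 ?_
  change ν.real _ ≤ μ.real _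
  rw [← integral_indicator_one hmB, ← integral_indicator_one hmA]
  refine (integral_mono ((integrable_const (1 : ℝ)).indicator hmB)
    (integrable_eval_stepLimit hB.measurable t) fun w => ?_).trans (hlim.trans
    (integral_mono (integrable_eval_stepLimit hA.measurable t)
      ((integrable_const (1 : ℝ)).indicator hmA) fun w => ?_))
  · by_cases hw : w ∈ {w | ∀ i, ∃ j, t < B w (i, j)}
    · rw [indicator_of_mem hw, eval_stepLimit_eq_one hw]
    · rw [indicator_of_notMem hw]
      exact (eval_gordonPoly_mem_Icc fun a => stepLimit_mem_Icc _ _).1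
  · by_cases hw : w ∈ {w | ∀ i, ∃ j, t ≤ A w (i, j)}
    · rw [indicator_of_mem hw]
      exact (eval_gordonPoly_mem_Icc fun a => stepLimit_mem_Icc _ _).2
    · rw [indicator_of_notMem hw, eval_stepLimit_eq_zero hw]

end GordonPolynomial

section StochasticDominance

variable {Ω Ω' : Type*} [MeasurableSpace Ω] [MeasurableSpace Ω']
  {μ : Measure Ω} {ν : Measure Ω'} {X : Ω → ℝ} {Y : Ω' → ℝ}

theorem measure_preimage_isUpperSet_le [IsFiniteMeasure μ] (hX : Measurable X)
    (h : ∀ t, ν {w | t < Y w} ≤ μ {w | t ≤ X w}) {U : Set ℝ} (hU : IsUpperSet U) :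
    ν (Y ⁻¹' U) ≤ μ (X ⁻¹' U) := by
  by_cases hmin : ∃ c ∈ U, ∀ x ∈ U, c ≤ x
  · obtain ⟨c, hc, hcU⟩ := hmin
    have hUc : X ⁻¹' U = ⋂ n : ℕ, {w | c - 1 / ((n : ℝ) + 1) ≤ X w} := by
      ext w
      simp only [mem_preimage, mem_iInter, mem_ofPred_eq]
      refine ⟨fun hw n => ?_, fun hw => hU (le_of_forall_pos_le_add fun ε hε => ?_) hc⟩
      · have : (0 : ℝ) < 1 / ((n : ℝ) + 1) := Nat.one_div_pos_of_nat
        linarith [hcU _ hw]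
      · obtain ⟨n, hn⟩ := exists_nat_one_div_lt hε
        linarith [hw n]
    have hanti : Antitone fun n : ℕ => {w | c - 1 / ((n : ℝ) + 1) ≤ X w} := by
      intro n k hnk w hw
      have := Nat.one_div_le_one_div (α := ℝ) hnk
      simp only [mem_ofPred_eq] at hw ⊢
      linarith
    rw [hUc, hanti.measure_iInter
      (fun n => (measurableSet_le measurable_const hX).nullMeasurableSet)
      ⟨0, measure_ne_top _ _⟩]
    refine le_iInf fun n => le_trans (measure_mono fun w hw => ?_) (h _)
    have : (0 : ℝ) < 1 / ((n : ℝ) + 1) := Nat.one_div_pos_of_nat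
    have := hcU _ hw
    simp only [mem_ofPred_eq]
    linarith
  · push Not at hmin
    have hUq : Y ⁻¹' U = ⋃ q : {q : ℚ // (q : ℝ) ∈ U}, {w | (q : ℝ) < Y w} := by
      ext w
      simp only [mem_preimage, mem_iUnion, mem_ofPred_eq]
      refine ⟨fun hw => ?_, fun ⟨q, hq⟩ => hU hq.le q.2⟩
      obtain ⟨d, hd, hdw⟩ := hmin _ hw
      obtain ⟨q, hq1, hq2⟩ := exists_rat_btwn hdw
      exact ⟨⟨q, hU hq1.le hd⟩, hq2⟩
    have hdir : Directed (· ⊆ ·) fun q : {q : ℚ // (q : ℝ) ∈ U} => {w | (q : ℝ) < Y w} := by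
      intro p q
      rcases le_total p.1 q.1 with hpq | hpq
      · exact ⟨p, subset_rfl, fun w (hw : (q : ℝ) < Y w) =>
          show (p : ℝ) < Y w from (Rat.cast_le.2 hpq).trans_lt hw⟩
      · exact ⟨q, fun w (hw : (p : ℝ) < Y w) =>
          show (q : ℝ) < Y w from (Rat.cast_le.2 hpq).trans_lt hw, subset_rfl⟩
    rw [hUq, hdir.measure_iUnion]
    exact iSup_le fun q => (h _).trans (measure_mono fun w hw => hU hw q.2)

theorem lintegral_ofReal_comp_eq {f : ℝ → ℝ} (hf : Measurable f) (hX : Measurable X) :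
    ∫⁻ w, ENNReal.ofReal (f (X w)) ∂μ
      = ∫⁻ s in Ioi (0 : ℝ), μ (X ⁻¹' {x | s < max (f x) 0}) := by
  have h := lintegral_eq_lintegral_meas_lt μ (f := fun w => max (f (X w)) 0)
    (ae_of_all _ fun w => le_max_right _ _) ((hf.comp hX).max measurable_const).aemeasurable
  simpa using h

theorem integral_comp_mono_le [IsProbabilityMeasure μ] [IsProbabilityMeasure ν]
    (hX : Measurable X) (hY : Measurable Y)
    (h : ∀ t, ν {w | t < Y w} ≤ μ {w | t ≤ X w}) {f : ℝ → ℝ} (hf : Monotone f)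
    (hfX : Integrable (fun w => f (X w)) μ) (hfY : Integrable (fun w => f (Y w)) ν) :
    ∫ w, f (Y w) ∂ν ≤ ∫ w, f (X w) ∂μ := by
  have hm : Measurable f := hf.measurable
  have hpos : ∫⁻ w, ENNReal.ofReal (f (Y w)) ∂ν ≤ ∫⁻ w, ENNReal.ofReal (f (X w)) ∂μ := by
    rw [lintegral_ofReal_comp_eq hm hY, lintegral_ofReal_comp_eq hm hX]
    exact lintegral_mono fun s => measure_preimage_isUpperSet_le hX h fun a b hab ha =>
      lt_of_lt_of_le ha (max_le_max_right 0 (hf hab))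
  have hm' : Measurable fun x => -f x := hm.neg
  have hneg : ∫⁻ w, ENNReal.ofReal (-f (X w)) ∂μ ≤ ∫⁻ w, ENNReal.ofReal (-f (Y w)) ∂ν := by
    rw [lintegral_ofReal_comp_eq hm' hY, lintegral_ofReal_comp_eq hm' hX]
    refine lintegral_mono fun s => ?_
    set L : Set ℝ := {x | s < max (-f x) 0} with hL
    have hLm : MeasurableSet L :=
      measurableSet_lt measurable_const (hm'.max measurable_const)
    have hup : IsUpperSet Lᶜ := IsLowerSet.compl fun a b hab ha =>
      lt_of_lt_of_le ha (max_le_max_right 0 (neg_le_neg (hf hab)))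
    have hc := measure_preimage_isUpperSet_le hX h hup
    rw [← compl_compl L, preimage_compl, preimage_compl (f := Y),
      prob_compl_eq_one_sub (hX hLm.compl), prob_compl_eq_one_sub (hY hLm.compl)]
    exact tsub_le_tsub_left hc 1
  rw [integral_eq_lintegral_pos_part_sub_lintegral_neg_part hfY,
    integral_eq_lintegral_pos_part_sub_lintegral_neg_part hfX]
  exact sub_le_sub
    (ENNReal.toReal_mono (by simpa using hfX.lintegral_lt_top.ne) hpos)
    (ENNReal.toReal_mono (by simpa using hfY.neg.lintegral_lt_top.ne) hneg)

end StochasticDominance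

section ConeProjection

variable {k : ℕ} {D : Set (Euc k)}

theorem metricProj_mem_and_le (hD : IsClosedConvexCone D) (y : Euc k) :
    metricProj D y ∈ D ∧ ∀ w ∈ D, dist y (metricProj D y) ≤ dist y w := by
  have hex : ∃ z, z ∈ D ∧ ∀ w ∈ D, dist y z ≤ dist y w := by
    obtain ⟨z, hz, hd⟩ := hD.1.exists_infDist_eq_dist ⟨0, hD.2.2.2⟩ y
    exact ⟨z, hz, fun w hw => hd ▸ infDist_le_dist_of_mem hw⟩
  rw [metricProj, dif_pos hex]
  exact hex.choose_spec

theorem inner_sub_metricProj_le (hD : IsClosedConvexCone D) (y : Euc k) {w : Euc k}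
    (hw : w ∈ D) : ⟪y - metricProj D y, w - metricProj D y⟫_ℝ ≤ 0 := by
  obtain ⟨hp, hmin⟩ := metricProj_mem_and_le hD y
  refine (norm_eq_iInf_iff_real_inner_le_zero hD.2.1 hp).1 ?_ w hw
  have : Nonempty D := ⟨⟨_, hp⟩⟩
  refine le_antisymm (le_ciInf fun w => ?_) ?_
  · simpa [dist_eq_norm] using hmin w w.2
  · exact ciInf_le ⟨0, by rintro _ ⟨w, rfl⟩; exact norm_nonneg _⟩ (⟨_, hp⟩ : D)

theorem inner_sub_metricProj_self (hD : IsClosedConvexCone D) (y : Euc k) :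
    ⟪y - metricProj D y, metricProj D y⟫_ℝ = 0 := by
  have hp := (metricProj_mem_and_le hD y).1
  have h0 := inner_sub_metricProj_le hD y hD.2.2.2
  have h2 := inner_sub_metricProj_le hD y (hD.2.2.1 2 (by norm_num) _ hp)
  rw [two_smul, add_sub_cancel_right] at h2
  rw [zero_sub, inner_neg_right] at h0
  linarith

theorem inner_metricProj_self (hD : IsClosedConvexCone D) (y : Euc k) :
    ⟪y, metricProj D y⟫_ℝ = ‖metricProj D y‖ ^ 2 := by
  have h := inner_sub_metricProj_self hD y
  rw [inner_sub_left, real_inner_self_eq_norm_sq] at h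
  linarith

theorem inner_le_norm_metricProj (hD : IsClosedConvexCone D) (y : Euc k) {z : Euc k}
    (hz : z ∈ D) (hz1 : ‖z‖ ≤ 1) : ⟪y, z⟫_ℝ ≤ ‖metricProj D y‖ := by
  have h1 := inner_sub_metricProj_le hD y hz
  rw [inner_sub_right, inner_sub_metricProj_self hD, sub_zero, inner_sub_left] at h1
  calc ⟪y, z⟫_ℝ ≤ ⟪metricProj D y, z⟫_ℝ := by linarith
    _ ≤ ‖metricProj D y‖ * ‖z‖ := real_inner_le_norm _ _
    _ ≤ ‖metricProj D y‖ := mul_le_of_le_one_right (norm_nonneg _) hz1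

theorem exists_inner_eq_norm_metricProj (hD : IsClosedConvexCone D) (y : Euc k) :
    ∃ z ∈ D, ‖z‖ ≤ 1 ∧ ⟪y, z⟫_ℝ = ‖metricProj D y‖ := by
  rcases eq_or_ne (metricProj D y) 0 with h | h
  · exact ⟨0, hD.2.2.2, by simp, by simp [h]⟩
  · have hn : ‖metricProj D y‖ ≠ 0 := norm_ne_zero_iff.2 h
    refine ⟨‖metricProj D y‖⁻¹ • metricProj D y, hD.2.2.1 _ (by positivity) _
      (metricProj_mem_and_le hD y).1, ?_, ?_⟩
    · rw [norm_smul, norm_inv, norm_norm, inv_mul_cancel₀ hn]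
    · rw [inner_smul_right, inner_metricProj_self hD]
      field_simp

theorem continuous_norm_metricProj (hD : IsClosedConvexCone D) :
    Continuous fun y => ‖metricProj D y‖ := by
  refine (LipschitzWith.of_le_add fun y y' => ?_).continuous
  obtain ⟨z, hz, hz1, hzy⟩ := exists_inner_eq_norm_metricProj hD y
  have h1 := inner_le_norm_metricProj hD y' hz hz1
  have h2 : ⟪y - y', z⟫_ℝ ≤ dist y y' := by
    rw [dist_eq_norm]
    exact (real_inner_le_norm _ _).trans (mul_le_of_le_one_right (norm_nonneg _) hz1)
  rw [inner_sub_left] at h2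
  linarith

end ConeProjection

section GordonCones

instance isProbabilityMeasure_stdGaussianE (k : ℕ) :
    IsProbabilityMeasure (stdGaussianE k) :=
  Measure.isProbabilityMeasure_map (EuclideanSpace.equiv (Fin k) ℝ).symm.continuous.aemeasurable

instance isProbabilityMeasure_stdGaussianPi (n m : ℕ) :
    IsProbabilityMeasure (stdGaussianPi n m) := by
  unfold stdGaussianPi
  infer_instance

theorem measurePreserving_equiv_stdGaussianE (k : ℕ) :
    MeasurePreserving (EuclideanSpace.equiv (Fin k) ℝ) (stdGaussianE k)
      (Measure.pi fun _ : Fin k => gaussianReal 0 1) := by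
  refine ⟨(EuclideanSpace.equiv (Fin k) ℝ).continuous.measurable, ?_⟩
  rw [stdGaussianE, Measure.map_map (EuclideanSpace.equiv (Fin k) ℝ).continuous.measurable
    (EuclideanSpace.equiv (Fin k) ℝ).symm.continuous.measurable]
  simp

variable {I : Type*} [Fintype I]

theorem gaussianIBP_stdGaussianE {k : ℕ} (v : I → Euc k) :
    GaussianIBP (stdGaussianE k) (fun g a => ⟪g, v a⟫_ℝ) (fun a b => ⟪v a, v b⟫_ℝ) := by
  have h := (GaussianIBP.pi fun i : Fin k =>
    GaussianIBP.gaussianReal fun a => v a i).comp_measurePreserving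
      (measurePreserving_equiv_stdGaussianE k)
  convert h using 2 with g
  · ext a
    simp [PiLp.inner_apply, mul_comm]
  · ext b
    simp [PiLp.inner_apply, mul_comm]

theorem gaussianIBP_stdGaussianPi {m n : ℕ} (x : I → Euc m) (y : I → Euc n) :
    GaussianIBP (stdGaussianPi n m) (fun G a => ⟪mulE (Matrix.of G) (x a), y a⟫_ℝ)
      (fun a b => ⟪x a, x b⟫_ℝ * ⟪y a, y b⟫_ℝ) := by
  have h := GaussianIBP.pi fun k : Fin n => GaussianIBP.pi fun l : Fin m =>
    GaussianIBP.gaussianReal fun a : I => x a l * y a k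
  convert h using 2 with G
  · rfl
  · ext a
    simp [mulE, PiLp.inner_apply, Matrix.toLpLin_apply, Matrix.mulVec, dotProduct,
      Finset.mul_sum, mul_comm]
    simp only [mul_assoc]
  · ext b
    simp only [PiLp.inner_apply, Finset.sum_mul_sum]
    rw [Finset.sum_comm]
    refine Finset.sum_congr rfl fun k _ => Finset.sum_congr rfl fun l _ => ?_
    simp
    ring

/-- Gordon's comparison for finitely many points of the sphere and of the ball. -/
theorem measure_gordon_inner_le {m n : ℕ} {ι J : Type*} [Fintype ι] [Fintype J]
    (x : ι → Euc m) (y : J → Euc n) (hx : ∀ i, ‖x i‖ = 1) (hy : ∀ j, ‖y j‖ ≤ 1) (t : ℝ) :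
    ((stdGaussianE n).prod (stdGaussianE m))
        {p | ∀ i, ∃ j, t < ⟪p.1, y j⟫_ℝ + ⟪p.2, -x i⟫_ℝ}
      ≤ ((stdGaussianPi n m).prod (gaussianReal 0 1))
        {p | ∀ i, ∃ j, t ≤ ⟪mulE (Matrix.of p.1) (x i), y j⟫_ℝ + p.2} := by
  have hA := (gaussianIBP_stdGaussianPi (fun a : ι × J => x a.1) fun a => y a.2).prod_add
    (GaussianIBP.gaussianReal fun _ : ι × J => (1 : ℝ))
  have hB := (gaussianIBP_stdGaussianE fun a : ι × J => y a.2).prod_add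
    (gaussianIBP_stdGaussianE fun a : ι × J => -x a.1)
  have h := measure_gordon_le hA hB (fun a b hab => ?_) (fun a b => ?_) t
  · simpa using h
  · simp [hab, hx, add_comm]
  · have h1 : ⟪x a.1, x b.1⟫_ℝ ≤ 1 := by
      simpa [hx] using real_inner_le_norm (x a.1) (x b.1)
    have h2 : ⟪y a.2, y b.2⟫_ℝ ≤ 1 := (real_inner_le_norm _ _).trans
      (mul_le_one₀ (hy _) (norm_nonneg _) (hy _))
    rw [inner_neg_neg]
    nlinarith [mul_nonneg (sub_nonneg.2 h1) (sub_nonneg.2 h2)]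

variable {m n : ℕ} {C : Set (Euc m)} {D : Set (Euc n)}

theorem nonempty_inter_sphere (hC : IsClosedConvexCone C) (hCne : C ≠ {0}) :
    (C ∩ sphere 0 1).Nonempty := by
  obtain ⟨x, hx, hx0⟩ : ∃ x ∈ C, x ≠ 0 := by
    by_contra! h
    exact hCne (Subset.antisymm h (by simpa using hC.2.2.2))
  refine ⟨‖x‖⁻¹ • x, hC.2.2.1 _ (by positivity) _ hx, ?_⟩
  rw [mem_sphere_zero_iff_norm, norm_smul, norm_inv, norm_norm,
    inv_mul_cancel₀ (norm_ne_zero_iff.2 hx0)]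

theorem continuous_mulE (A : Matrix (Fin n) (Fin m) ℝ) : Continuous (mulE A) :=
  (Matrix.toEuclideanLin A).continuous_of_finiteDimensional

theorem measurable_mulE_left (x : Euc m) :
    Measurable fun G : Fin n → Fin m → ℝ => mulE (Matrix.of G) x := by
  refine Continuous.measurable ?_
  unfold mulE
  simp only [Matrix.toLpLin_apply]
  fun_prop

theorem le_resSval_iff (hD : IsClosedConvexCone D) {x : ℕ → ↥(C ∩ sphere (0 : Euc m) 1)}
    (hx : DenseRange x) (A : Matrix (Fin n) (Fin m) ℝ) (r : ℝ) :
    r ≤ resSval C D A ↔ ∀ i, r ≤ ‖metricProj D (mulE A (x i))‖ := by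
  have hbdd : BddBelow ((fun x => ‖metricProj D (mulE A x)‖) '' (C ∩ sphere 0 1)) :=
    ⟨0, by rintro _ ⟨z, _, rfl⟩; exact norm_nonneg _⟩
  refine ⟨fun h i => h.trans (csInf_le hbdd ⟨x i, (x i).2, rfl⟩), fun h => ?_⟩
  refine le_csInf (⟨_, (x 0), (x 0).2, rfl⟩) ?_
  rintro _ ⟨z, hz, rfl⟩
  have hcl : IsClosed {z : ↥(C ∩ sphere (0 : Euc m) 1) | r ≤ ‖metricProj D (mulE A z)‖} :=
    isClosed_le continuous_const ((continuous_norm_metricProj hD).comp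
      ((continuous_mulE A).comp continuous_subtype_val))
  have := hcl.closure_subset_iff.2 (range_subset_iff.2 h) (hx ⟨z, hz⟩)
  exact this

theorem measurable_resSval (hC : IsClosedConvexCone C) (hCne : C ≠ {0})
    (hD : IsClosedConvexCone D) :
    Measurable fun G : Fin n → Fin m → ℝ => resSval C D (Matrix.of G) := by
  have : Nonempty ↥(C ∩ sphere (0 : Euc m) 1) := (nonempty_inter_sphere hC hCne).to_subtype
  refine measurable_of_Ici fun r => ?_
  have hset : (fun G : Fin n → Fin m → ℝ => resSval C D (Matrix.of G)) ⁻¹' Ici r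
      = ⋂ i, {G | r ≤ ‖metricProj D (mulE (Matrix.of G)
        (TopologicalSpace.denseSeq ↥(C ∩ sphere (0 : Euc m) 1) i))‖} := by
    ext G
    simpa using le_resSval_iff hD (TopologicalSpace.denseRange_denseSeq _) (Matrix.of G) r
  rw [hset]
  exact MeasurableSet.iInter fun i => measurableSet_le measurable_const
    ((continuous_norm_metricProj hD).measurable.comp (measurable_mulE_left _))

/-- The distribution of `σ_{C→D}(G) + γ` stochastically dominates that of
`‖Proj_D g'‖ - ‖Proj_C g‖`. -/
theorem measure_norm_metricProj_sub_le_resSval_add (hC : IsClosedConvexCone C)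
    (hCne : C ≠ {0}) (hD : IsClosedConvexCone D) (t : ℝ) :
    ((stdGaussianE n).prod (stdGaussianE m))
        {p | t < ‖metricProj D p.1‖ - ‖metricProj C p.2‖}
      ≤ ((stdGaussianPi n m).prod (gaussianReal 0 1))
        {p | t ≤ resSval C D (Matrix.of p.1) + p.2} := by
  have : Nonempty ↥(C ∩ sphere (0 : Euc m) 1) := (nonempty_inter_sphere hC hCne).to_subtype
  have : Nonempty ↥(D ∩ closedBall (0 : Euc n) 1) := ⟨⟨0, hD.2.2.2, by simp⟩⟩
  set x := TopologicalSpace.denseSeq ↥(C ∩ sphere (0 : Euc m) 1)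
  set y := TopologicalSpace.denseSeq ↥(D ∩ closedBall (0 : Euc n) 1)
  have hx1 : ∀ i, ‖(x i : Euc m)‖ = 1 := fun i => mem_sphere_zero_iff_norm.1 (x i).2.2
  have hy1 : ∀ j, ‖(y j : Euc n)‖ ≤ 1 := fun j => mem_closedBall_zero_iff.1 (y j).2.2
  have hleft : {p : Euc n × Euc m | t < ‖metricProj D p.1‖ - ‖metricProj C p.2‖}
      ⊆ ⋃ M : ℕ, {p | ∃ j < M, t < ⟪p.1, (y j : Euc n)⟫_ℝ - ‖metricProj C p.2‖} := by
    intro p hp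
    obtain ⟨z, hz, hz1, hzp⟩ := exists_inner_eq_norm_metricProj hD p.1
    have hopen : IsOpen {z : ↥(D ∩ closedBall (0 : Euc n) 1) |
        t < ⟪p.1, (z : Euc n)⟫_ℝ - ‖metricProj C p.2‖} :=
      isOpen_lt continuous_const (by fun_prop)
    obtain ⟨j, hj⟩ := (TopologicalSpace.denseRange_denseSeq
      ↥(D ∩ closedBall (0 : Euc n) 1)).exists_mem_open hopen
      ⟨⟨z, hz, mem_closedBall_zero_iff.2 hz1⟩, by simpa [hzp] using hp⟩
    exact mem_iUnion.2 ⟨j + 1, j, Nat.lt_succ_self j, hj⟩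
  have hright : {p : (Fin n → Fin m → ℝ) × ℝ | t ≤ resSval C D (Matrix.of p.1) + p.2}
      = ⋂ N : ℕ, {p | ∀ i < N, t ≤ ‖metricProj D (mulE (Matrix.of p.1) (x i))‖ + p.2} := by
    ext p
    have h := le_resSval_iff hD (TopologicalSpace.denseRange_denseSeq
      ↥(C ∩ sphere (0 : Euc m) 1)) (Matrix.of p.1) (t - p.2)
    simp only [sub_le_iff_le_add] at h
    simp only [mem_iInter, mem_ofPred_eq, h]
    exact ⟨fun h N i _ => h i, fun h i => h (i + 1) i (Nat.lt_succ_self i)⟩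
  have hmono : Monotone fun M : ℕ => {p : Euc n × Euc m |
      ∃ j < M, t < ⟪p.1, (y j : Euc n)⟫_ℝ - ‖metricProj C p.2‖} :=
    fun M M' h p ⟨j, hj, hp⟩ => ⟨j, hj.trans_le h, hp⟩
  have hanti : Antitone fun N : ℕ => {p : (Fin n → Fin m → ℝ) × ℝ |
      ∀ i < N, t ≤ ‖metricProj D (mulE (Matrix.of p.1) (x i))‖ + p.2} :=
    fun N N' h p hp i hi => hp i (hi.trans_le h)
  refine (measure_mono hleft).trans ?_
  rw [hright, hmono.measure_iUnion, hanti.measure_iInter (fun N => ?_)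
    ⟨0, measure_ne_top _ _⟩]
  · refine iSup_le fun M => le_iInf fun N => ?_
    refine le_trans (measure_mono ?_) ((measure_gordon_inner_le (fun i : Fin N => (x i : Euc m))
      (fun j : Fin M => (y j : Euc n)) (fun i => hx1 i) (fun j => hy1 j) t).trans
      (measure_mono ?_))
    · rintro p ⟨j, hj, hp⟩ i
      refine ⟨⟨j, hj⟩, hp.trans_le ?_⟩
      rw [inner_neg_right]
      linarith [inner_le_norm_metricProj hC p.2 (x i).2.1 (hx1 i).le]
    · intro p hp i hi
      obtain ⟨j, hj⟩ := hp ⟨i, hi⟩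
      exact hj.trans (add_le_add_left
        (inner_le_norm_metricProj hD _ (y j).2.1 (hy1 j)) _)
  · refine MeasurableSet.nullMeasurableSet ?_
    simp only [ofPred_forall]
    refine MeasurableSet.iInter fun i => MeasurableSet.iInter fun _ =>
      measurableSet_le measurable_const (Measurable.add ?_ measurable_snd)
    exact (continuous_norm_metricProj hD).measurable.comp
      ((measurable_mulE_left _).comp measurable_fst)

end GordonCones

/-- For closed convex cones `C ≠ {0}`, `D`, a standard Gaussian matrix `G`, an
independent standard Gaussian `γ`, independent standard Gaussian vectors `g, g'`, and a
monotone Borel `f` with both sides integrable,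
`E[f(σ_{C→D}(G) + γ)] ≥ E[f(‖Proj_D g'‖ − ‖Proj_C g‖)]`. -/
theorem statement2 {m n : ℕ} (C : Set (Euc m)) (D : Set (Euc n))
    (hC : IsClosedConvexCone C) (hCne : C ≠ {0}) (hD : IsClosedConvexCone D)
    (f : ℝ → ℝ) (hf_meas : Measurable f) (hf_mono : Monotone f)
    (hint1 : Integrable
      (fun p : (Fin n → Fin m → ℝ) × ℝ => f (resSval C D (Matrix.of p.1) + p.2))
      ((stdGaussianPi n m).prod (gaussianReal 0 1)))
    (hint2 : Integrable
      (fun p : Euc n × Euc m => f (‖metricProj D p.1‖ - ‖metricProj C p.2‖))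
      ((stdGaussianE n).prod (stdGaussianE m))) :
    ∫ p, f (‖metricProj D p.1‖ - ‖metricProj C p.2‖)
        ∂((stdGaussianE n).prod (stdGaussianE m))
      ≤ ∫ p, f (resSval C D (Matrix.of p.1) + p.2)
          ∂((stdGaussianPi n m).prod (gaussianReal 0 1)) := by
  exact integral_comp_mono_le
    (((measurable_resSval hC hCne hD).comp measurable_fst).add measurable_snd)
    (((continuous_norm_metricProj hD).measurable.comp measurable_fst).sub
      ((continuous_norm_metricProj hC).measurable.comp measurable_snd))
    (measure_norm_metricProj_sub_le_resSval_add hC hCne hD) hf_mono hint1 hint2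

end
end

section
/- Let C ⊆ ℝ^m and D ⊆ ℝ^n be closed convex cones with nonempty interior. Then: (1) 𝒫(C,D) and 𝒟(C,D) are closed subsets of ℝ^{n×m}; (2) if m = n, C = ℝ^m and D = ℝ^n, then 𝒫(C,D) ∪ 𝒟(C,D) = { A ∈ ℝ^{m×m} : det A = 0 }, and in every other case 𝒫(C,D) ∪ 𝒟(C,D) = ℝ^{n×m}. -/
open MeasureTheory ProbabilityTheory Metric Set
open scoped InnerProductSpace
open scoped Classical
open scoped Pointwise

noncomputable section

theorem inner_mulE_left {m n : ℕ} (A : Matrix (Fin n) (Fin m) ℝ) (x : Euc m) (y : Euc n) :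
    ⟪mulE A x, y⟫_ℝ = ⟪x, mulE A.transpose y⟫_ℝ := by
  have h := Matrix.toEuclideanLin_conjTranspose_eq_adjoint A
  rw [Matrix.conjTranspose_eq_transpose_of_trivial] at h
  rw [mulE, mulE, h, LinearMap.adjoint_inner_right]

theorem mulE_neg_left {m n : ℕ} (A : Matrix (Fin n) (Fin m) ℝ) (x : Euc m) :
    mulE (-A) x = -mulE A x := by
  simp [mulE]

theorem mulE_zero_right {m n : ℕ} (A : Matrix (Fin n) (Fin m) ℝ) : mulE A 0 = 0 := by
  simp [mulE]

theorem mulE_add_right {m n : ℕ} (A : Matrix (Fin n) (Fin m) ℝ) (x y : Euc m) :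
    mulE A (x + y) = mulE A x + mulE A y := by
  simp [mulE]

theorem mulE_smul_right {m n : ℕ} (A : Matrix (Fin n) (Fin m) ℝ) (c : ℝ) (x : Euc m) :
    mulE A (c • x) = c • mulE A x := by
  simp [mulE]

theorem continuous_mulE_s8 {m n : ℕ} :
    Continuous fun p : Matrix (Fin n) (Fin m) ℝ × Euc m => mulE p.1 p.2 := by
  have h : (fun p : Matrix (Fin n) (Fin m) ℝ × Euc m => mulE p.1 p.2) =
      fun p => WithLp.toLp 2 (p.1.mulVec (WithLp.ofLp p.2)) := rfl
  rw [h]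
  exact (PiLp.continuous_toLp 2 _).comp
    (continuous_fst.matrix_mulVec ((PiLp.continuous_ofLp 2 _).comp continuous_snd))

theorem exists_mulE_eq_zero_of_lt {m n : ℕ} (h : n < m) (A : Matrix (Fin n) (Fin m) ℝ) :
    ∃ x ≠ 0, mulE A x = 0 := by
  have hker : LinearMap.ker (Matrix.toEuclideanLin A) ≠ ⊥ :=
    LinearMap.ker_ne_bot_of_finrank_lt (by simpa using h)
  obtain ⟨x, hx, hx0⟩ := (Submodule.ne_bot_iff _).1 hker
  exact ⟨x, hx0, hx⟩

theorem exists_mulE_eq_zero_iff {n : ℕ} (A : Matrix (Fin n) (Fin n) ℝ) :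
    (∃ x ≠ 0, mulE A x = 0) ↔ A.det = 0 := by
  rw [← Matrix.exists_mulVec_eq_zero_iff]
  constructor
  · rintro ⟨x, hx, h⟩
    exact ⟨WithLp.ofLp x, by simpa using hx, congrArg WithLp.ofLp h⟩
  · rintro ⟨x, hx, h⟩
    exact ⟨WithLp.toLp 2 x, by simpa using hx, congrArg (WithLp.toLp 2) h⟩

theorem isClosed_polarCone {k : ℕ} (S : Set (Euc k)) : IsClosed (polarCone S) := by
  simp only [polarCone, Set.ofPred_forall]
  exact isClosed_biInter fun x _ =>
    isClosed_le (continuous_const.inner continuous_id) continuous_const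

theorem zero_mem_polarCone {k : ℕ} (S : Set (Euc k)) : (0 : Euc k) ∈ polarCone S := by
  simp [polarCone]

theorem add_mem_polarCone {k : ℕ} {S : Set (Euc k)} {x y : Euc k} (hx : x ∈ polarCone S)
    (hy : y ∈ polarCone S) : x + y ∈ polarCone S := fun w hw => by
  rw [inner_add_right]
  exact add_nonpos (hx w hw) (hy w hw)

theorem smul_mem_polarCone {k : ℕ} {S : Set (Euc k)} {c : ℝ} (hc : 0 ≤ c) {x : Euc k}
    (hx : x ∈ polarCone S) : c • x ∈ polarCone S := fun w hw => by
  rw [inner_smul_right]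
  exact mul_nonpos_of_nonneg_of_nonpos hc (hx w hw)

theorem polarCone_univ {k : ℕ} : polarCone (Set.univ : Set (Euc k)) = {0} := by
  ext z
  refine ⟨fun hz => ?_, ?_⟩
  · exact inner_self_eq_zero.1 (le_antisymm (hz z trivial) real_inner_self_nonneg)
  · rintro rfl
    exact zero_mem_polarCone _

theorem exists_pos_add_smul_mem {k : ℕ} {S : Set (Euc k)} {x : Euc k} (hx : x ∈ interior S)
    (v : Euc k) : ∃ t : ℝ, 0 < t ∧ x + t • v ∈ S := by
  have hcont : Continuous fun t : ℝ => x + t • v := by fun_prop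
  have hnhds : ∀ᶠ t : ℝ in nhds 0, x + t • v ∈ S :=
    hcont.continuousAt (by simpa using mem_interior_iff_mem_nhds.1 hx)
  obtain ⟨t, ht, ht0⟩ :=
    ((hnhds.filter_mono nhdsWithin_le_nhds).and (self_mem_nhdsWithin (s := Set.Ioi 0))).exists
  exact ⟨t, ht0, ht⟩

theorem eq_zero_of_mem_polarCone_of_neg_mem {k : ℕ} {S : Set (Euc k)}
    (hS : (interior S).Nonempty) {z : Euc k} (hz : z ∈ polarCone S) (hz' : -z ∈ polarCone S) :
    z = 0 := by
  have horth : ∀ x ∈ S, ⟪x, z⟫_ℝ = 0 := fun x hx =>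
    le_antisymm (hz x hx) (by simpa using hz' x hx)
  obtain ⟨x, hx⟩ := hS
  obtain ⟨t, ht, hxt⟩ := exists_pos_add_smul_mem hx z
  have h := horth _ hxt
  rw [inner_add_left, horth x (interior_subset hx), zero_add, real_inner_smul_left] at h
  exact inner_self_eq_zero.1 ((mul_eq_zero.1 h).resolve_left ht.ne')

namespace IsClosedConvexCone

variable {k : ℕ} {C : Set (Euc k)}

theorem smul_mem (hC : IsClosedConvexCone C) {c : ℝ} (hc : 0 ≤ c) {x : Euc k} (hx : x ∈ C) :
    c • x ∈ C :=
  hC.2.2.1 c hc x hx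

theorem zero_mem (hC : IsClosedConvexCone C) : (0 : Euc k) ∈ C :=
  hC.2.2.2

theorem add_mem (hC : IsClosedConvexCone C) {x y : Euc k} (hx : x ∈ C) (hy : y ∈ C) :
    x + y ∈ C := by
  have hmid : (1 / 2 : ℝ) • x + (1 / 2 : ℝ) • y ∈ C :=
    hC.2.1 hx hy (by norm_num) (by norm_num) (by norm_num)
  have h := hC.smul_mem zero_le_two hmid
  simpa [smul_smul] using h

/-- A closed convex cone as a bundled `ProperCone`. -/
def toProperCone (hC : IsClosedConvexCone C) : ProperCone ℝ (Euc k) where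
  carrier := C
  add_mem' := hC.add_mem
  zero_mem' := hC.zero_mem
  smul_mem' c _ hx := hC.smul_mem c.2 hx
  isClosed' := hC.1

theorem exists_mem_polarCone_inner_pos (hC : IsClosedConvexCone C) {y : Euc k} (hy : y ∉ C) :
    ∃ z ∈ polarCone C, 0 < ⟪y, z⟫_ℝ := by
  obtain ⟨z, hz, hyz⟩ := hC.toProperCone.hyperplane_separation' (x₀ := y) hy
  refine ⟨-z, fun x hx => ?_, by simpa using hyz⟩
  simpa using hz x hx

theorem mem_of_forall_polarCone (hC : IsClosedConvexCone C) {y : Euc k}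
    (hy : ∀ z ∈ polarCone C, ⟪y, z⟫_ℝ ≤ 0) : y ∈ C := by
  by_contra h
  obtain ⟨z, hz, hyz⟩ := hC.exists_mem_polarCone_inner_pos h
  exact (hy z hz).not_gt hyz

theorem eq_univ_of_neg_mem_of_mem_interior (hC : IsClosedConvexCone C) {x : Euc k}
    (hx : x ∈ interior C) (hx' : -x ∈ C) : C = Set.univ := by
  refine Set.eq_univ_of_forall fun v => ?_
  obtain ⟨t, ht, htv⟩ := exists_pos_add_smul_mem hx v
  have h := hC.smul_mem (inv_nonneg.2 ht.le) (hC.add_mem htv hx')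
  simpa [smul_smul, ht.ne'] using h

end IsClosedConvexCone

theorem Convex.eq_univ_of_dense {E : Type*} [NormedAddCommGroup E] [NormedSpace ℝ E]
    [FiniteDimensional ℝ E] {s : Set E} (hs : Convex ℝ s) (hd : Dense s) : s = Set.univ := by
  have hspan : affineSpan ℝ s = ⊤ := by
    have hclosed : IsClosed (affineSpan ℝ s : Set E) :=
      AffineSubspace.closed_of_finiteDimensional _
    rw [← AffineSubspace.coe_eq_univ_iff, ← hclosed.closure_eq]
    exact (hd.mono (subset_affineSpan ℝ s)).closure_eq
  have h := hs.interior_closure_eq_interior_of_nonempty_interior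
    (hs.interior_nonempty_iff_affineSpan_eq_top.2 hspan)
  rw [hd.closure_eq, interior_univ] at h
  exact interior_eq_univ.1 h.symm

theorem PointedCone.eq_top_of_forall_inner_nonneg {E : Type*} [NormedAddCommGroup E]
    [InnerProductSpace ℝ E] [FiniteDimensional ℝ E] (K : PointedCone ℝ E)
    (hK : ∀ y : E, (∀ x ∈ K, 0 ≤ ⟪x, y⟫_ℝ) → y = 0) : K = ⊤ := by
  have : CompleteSpace E := FiniteDimensional.complete ℝ E
  have hd : Dense (K : Set E) := by
    intro b
    by_contra hb
    obtain ⟨y, hy, hby⟩ := ProperCone.hyperplane_separation' (x₀ := b) (Submodule.closure K) hb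
    have := hK y fun x hx => hy x (subset_closure hx)
    simp [this] at hby
  exact SetLike.coe_injective (K.convex.eq_univ_of_dense hd)

theorem dualSet_eq_preimage {m n : ℕ} (C : Set (Euc m)) (D : Set (Euc n)) :
    dualSet C D = (fun A : Matrix (Fin n) (Fin m) ℝ => -A.transpose) ⁻¹' primalSet D C := by
  ext A
  simp [dualSet, primalSet, mulE_neg_left]

theorem isClosed_primalSet {m n : ℕ} {C : Set (Euc m)} (hC : IsClosedConvexCone C)
    (D : Set (Euc n)) : IsClosed (primalSet C D) := by
  have himage : primalSet C D = Prod.fst ''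
      {p : Matrix (Fin n) (Fin m) ℝ × sphere (0 : Euc m) 1 |
        (p.2 : Euc m) ∈ C ∧ mulE p.1 p.2 ∈ polarCone D} := by
    ext A
    constructor
    · rintro ⟨x, hx, hx0, hAx⟩
      have hnorm : 0 ≤ ‖x‖⁻¹ := inv_nonneg.2 (norm_nonneg x)
      refine ⟨(A, ⟨‖x‖⁻¹ • x, by simp [norm_smul, hx0]⟩), ⟨hC.smul_mem hnorm hx, ?_⟩, rfl⟩
      rw [mulE_smul_right]
      exact smul_mem_polarCone hnorm hAx
    · rintro ⟨⟨B, x⟩, ⟨hx, hBx⟩, rfl⟩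
      exact ⟨x, hx, ne_zero_of_mem_unit_sphere x, hBx⟩
  rw [himage]
  refine isClosedMap_fst_of_compactSpace _ (IsClosed.inter ?_ ?_)
  · exact hC.1.preimage (continuous_subtype_val.comp continuous_snd)
  · exact (isClosed_polarCone D).preimage (continuous_mulE_s8.comp
      (continuous_fst.prodMk (continuous_subtype_val.comp continuous_snd)))

theorem isClosed_dualSet {m n : ℕ} (C : Set (Euc m)) {D : Set (Euc n)}
    (hD : IsClosedConvexCone D) : IsClosed (dualSet C D) := by
  rw [dualSet_eq_preimage]
  exact (isClosed_primalSet hD C).preimage continuous_id.matrix_transpose.neg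

theorem mem_primalSet_univ {m n : ℕ} {A : Matrix (Fin n) (Fin m) ℝ} :
    A ∈ primalSet Set.univ Set.univ ↔ ∃ x ≠ 0, mulE A x = 0 := by
  simp [primalSet, polarCone_univ]

theorem mem_dualSet_univ {m n : ℕ} {A : Matrix (Fin n) (Fin m) ℝ} :
    A ∈ dualSet Set.univ Set.univ ↔ ∃ y ≠ 0, mulE A.transpose y = 0 := by
  simp [dualSet, polarCone_univ]

/-- If `A` is not dual feasible, then `A C - D°` is all of `ℝ^n`. -/
theorem exists_mulE_sub_eq_of_notMem_dualSet {m n : ℕ} {C : Set (Euc m)} {D : Set (Euc n)}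
    (hC : IsClosedConvexCone C) (hD : IsClosedConvexCone D) {A : Matrix (Fin n) (Fin m) ℝ}
    (hA : A ∉ dualSet C D) (b : Euc n) :
    ∃ x ∈ C, ∃ z ∈ polarCone D, mulE A x - z = b := by
  let K : PointedCone ℝ (Euc n) :=
    { carrier := {b | ∃ x ∈ C, ∃ z ∈ polarCone D, mulE A x - z = b}
      zero_mem' := ⟨0, hC.zero_mem, 0, zero_mem_polarCone D, by simp [mulE_zero_right]⟩
      add_mem' := by
        rintro _ _ ⟨x, hx, z, hz, rfl⟩ ⟨x', hx', z', hz', rfl⟩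
        exact ⟨x + x', hC.add_mem hx hx', z + z', add_mem_polarCone hz hz', by
          rw [mulE_add_right]; abel⟩
      smul_mem' := by
        rintro c _ ⟨x, hx, z, hz, rfl⟩
        exact ⟨(c : ℝ) • x, hC.smul_mem c.2 hx, (c : ℝ) • z, smul_mem_polarCone c.2 hz, by
          rw [mulE_smul_right, ← smul_sub]; rfl⟩ }
  have hK : K = ⊤ := by
    refine K.eq_top_of_forall_inner_nonneg fun y hy => ?_
    by_contra hy0
    refine hA ⟨y, hD.mem_of_forall_polarCone fun z hz => ?_, hy0, fun x hx => ?_⟩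
    · have h := hy (-z) ⟨0, hC.zero_mem, z, hz, by simp [mulE_zero_right]⟩
      rw [real_inner_comm]
      simpa using h
    · have h := hy (mulE A x) ⟨x, hx, 0, zero_mem_polarCone D, sub_zero _⟩
      rw [inner_mulE_left] at h
      simpa using h
  exact hK.ge (Submodule.mem_top (x := b))

theorem mem_primalSet_union_dualSet_of_ne_univ {m n : ℕ} {C : Set (Euc m)} {D : Set (Euc n)}
    (hC : IsClosedConvexCone C) (hCint : (interior C).Nonempty)
    (hD : IsClosedConvexCone D) (hDint : (interior D).Nonempty)
    (h : C ≠ Set.univ ∨ D ≠ Set.univ) (A : Matrix (Fin n) (Fin m) ℝ) :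
    A ∈ primalSet C D ∪ dualSet C D := by
  by_cases hA : A ∈ dualSet C D
  · exact Or.inr hA
  refine Or.inl ?_
  rcases h with hne | hne
  · obtain ⟨x₀, hx₀⟩ := hCint
    obtain ⟨x, hx, z, hz, hxz⟩ := exists_mulE_sub_eq_of_notMem_dualSet hC hD hA (-mulE A x₀)
    refine ⟨x₀ + x, hC.add_mem (interior_subset hx₀) hx, fun h0 => hne ?_, ?_⟩
    · refine hC.eq_univ_of_neg_mem_of_mem_interior hx₀ ?_
      rwa [← eq_neg_of_add_eq_zero_right h0]
    · have hsum : mulE A (x₀ + x) = z := by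
        rw [mulE_add_right, sub_eq_iff_eq_add.1 hxz]; abel
      rwa [hsum]
  · obtain ⟨y, hy⟩ := (Set.ne_univ_iff_exists_notMem D).1 hne
    obtain ⟨z₀, hz₀, hyz₀⟩ := hD.exists_mem_polarCone_inner_pos hy
    obtain ⟨x, hx, z, hz, hxz⟩ := exists_mulE_sub_eq_of_notMem_dualSet hC hD hA z₀
    have hsum : mulE A x = z₀ + z := sub_eq_iff_eq_add.1 hxz
    refine ⟨x, hx, ?_, hsum ▸ add_mem_polarCone hz₀ hz⟩
    rintro rfl
    rw [mulE_zero_right] at hsum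
    rw [eq_neg_of_add_eq_zero_right hsum.symm] at hz
    simp [eq_zero_of_mem_polarCone_of_neg_mem hDint hz₀ hz] at hyz₀

/-- For closed convex cones `C ⊆ ℝ^m`, `D ⊆ ℝ^n` with nonempty interior:
(1) `𝒫(C,D)` and `𝒟(C,D)` are closed; (2) if `m = n`, `C = ℝ^m` and `D = ℝ^n` then
`𝒫 ∪ 𝒟 = {A | det A = 0}`, and in every other case `𝒫 ∪ 𝒟 = ℝ^{n×m}`. -/
theorem statement8 {m n : ℕ} (C : Set (Euc m)) (D : Set (Euc n))
    (hC : IsClosedConvexCone C) (hCint : (interior C).Nonempty)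
    (hD : IsClosedConvexCone D) (hDint : (interior D).Nonempty) :
    IsClosed (primalSet C D) ∧ IsClosed (dualSet C D) ∧
    (∀ h : m = n, C = Set.univ → D = Set.univ →
      primalSet C D ∪ dualSet C D
        = {A | (Matrix.reindex (Equiv.refl (Fin n)) (finCongr h) A).det = 0}) ∧
    (¬(m = n ∧ C = Set.univ ∧ D = Set.univ) →
      primalSet C D ∪ dualSet C D = Set.univ) := by
  refine ⟨isClosed_primalSet hC D, isClosed_dualSet C hD, ?_, fun h => ?_⟩
  · rintro rfl rfl rfl
    ext A
    have hdet : (Matrix.reindex (Equiv.refl (Fin m)) (finCongr rfl) A).det = A.det := rfl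
    rw [Set.mem_union, mem_primalSet_univ, mem_dualSet_univ, exists_mulE_eq_zero_iff,
      exists_mulE_eq_zero_iff, Matrix.det_transpose, or_self, Set.mem_ofPred_eq, hdet]
  · refine Set.eq_univ_of_forall fun A => ?_
    by_cases hne : C ≠ Set.univ ∨ D ≠ Set.univ
    · exact mem_primalSet_union_dualSet_of_ne_univ hC hCint hD hDint hne A
    obtain ⟨rfl, rfl⟩ : C = Set.univ ∧ D = Set.univ := by simpa [not_or] using hne
    rcases lt_trichotomy m n with hlt | heq | hgt
    · exact Or.inr (mem_dualSet_univ.2 (exists_mulE_eq_zero_of_lt hlt _))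
    · exact absurd ⟨heq, rfl, rfl⟩ h
    · exact Or.inl (mem_primalSet_univ.2 (exists_mulE_eq_zero_of_lt hgt A))

end
end

section
/- Let K₁, K₂ ⊆ ℝ^N be convex bodies with 0 ∈ K₁ ∩ K₂ such that K₂ is a 0-contraction of K₁, and let f : [0,∞) → ℝ be monotonically increasing and convex with f(h_{K₁}(g)) and f(h_{K₂}(g)) integrable for a standard Gaussian vector g in ℝ^N (note h_{K_i}(g) ≥ 0 since 0 ∈ K_i). Then μ_f(K₂) ≤ μ_f(K₁). -/
open MeasureTheory ProbabilityTheory Metric Set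
open scoped InnerProductSpace
open scoped Classical
open scoped Pointwise

noncomputable section

section Stein

variable {E : Type*} [NormedAddCommGroup E] [InnerProductSpace ℝ E]

/-- The density of the standard Gaussian measure with respect to Lebesgue measure. -/
def stdGaussianDensity (E : Type*) [NormedAddCommGroup E] [InnerProductSpace ℝ E] (x : E) : ℝ :=
  ((2 * Real.pi) ^ (Module.finrank ℝ E / 2 : ℝ))⁻¹ * Real.exp (-‖x‖ ^ 2 / 2)

lemma stdGaussianDensity_nonneg (x : E) : 0 ≤ stdGaussianDensity E x := by
  unfold stdGaussianDensity; positivity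

lemma continuous_stdGaussianDensity : Continuous (stdGaussianDensity E) := by
  unfold stdGaussianDensity; fun_prop

lemma hasLineDerivAt_stdGaussianDensity (x v : E) :
    HasLineDerivAt ℝ (stdGaussianDensity E) (-(⟪x, v⟫_ℝ * stdGaussianDensity E x)) x v := by
  have h : HasDerivAt (fun t : ℝ => ‖x + t • v‖ ^ 2) (2 * ⟪x, v⟫_ℝ) 0 := by
    have := ((hasDerivAt_id (0 : ℝ)).smul_const v).const_add x |>.norm_sq
    simpa using this
  have h2 := ((h.neg.div_const 2).exp).const_mul
    ((2 * Real.pi) ^ (Module.finrank ℝ E / 2 : ℝ))⁻¹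
  unfold HasLineDerivAt stdGaussianDensity
  refine h2.congr_deriv ?_
  simp
  ring

variable [FiniteDimensional ℝ E] [MeasurableSpace E] [BorelSpace E]

lemma integrable_stdGaussianDensity : Integrable (stdGaussianDensity E) := by
  have h := GaussianFourier.integrable_cexp_neg_mul_sq_norm_add (V := E) (b := 1 / 2)
    (by norm_num) 0 0
  refine (h.norm.const_mul ((2 * Real.pi) ^ (Module.finrank ℝ E / 2 : ℝ))⁻¹).congr ?_
  refine Filter.Eventually.of_forall fun x => ?_
  simp only [stdGaussianDensity, Complex.norm_exp]
  congr 2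
  norm_cast
  simp [-Complex.ofReal_pow]
  ring

lemma stdGaussian_eq_withDensity :
    stdGaussian E = volume.withDensity fun x => ENNReal.ofReal (stdGaussianDensity E x) := by
  have := isFiniteMeasure_withDensity_ofReal (μ := (volume : Measure E))
    (integrable_stdGaussianDensity (E := E)).2
  refine Measure.ext_of_charFun ?_
  ext t
  rw [charFun_stdGaussian, charFun_apply, integral_withDensity_eq_integral_toReal_smul
    (by exact continuous_stdGaussianDensity.measurable.ennreal_ofReal) (by simp)]
  have h := GaussianFourier.integral_cexp_neg_mul_sq_norm_add (V := E) (b := 1 / 2)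
    (by norm_num) Complex.I t
  have hc : ((2 * Real.pi : ℂ) ^ (Module.finrank ℝ E / 2 : ℂ))
      = (((2 * Real.pi) ^ (Module.finrank ℝ E / 2 : ℝ) : ℝ) : ℂ) := by
    rw [Complex.ofReal_cpow (by positivity)]; push_cast; rfl
  have hne : ((2 * Real.pi) ^ (Module.finrank ℝ E / 2 : ℝ) : ℝ) ≠ 0 := by positivity
  calc Complex.exp (-‖t‖ ^ 2 / 2)
      = (((2 * Real.pi) ^ (Module.finrank ℝ E / 2 : ℝ) : ℝ) : ℂ)⁻¹ *
        ∫ v : E, Complex.exp (-(1 / 2) * ‖v‖ ^ 2 + Complex.I * ⟪t, v⟫_ℝ) := by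
        rw [h, show (Real.pi / (1 / 2) : ℂ) = 2 * Real.pi by ring, hc, ← mul_assoc,
          inv_mul_cancel₀ (by exact_mod_cast hne), one_mul, Complex.I_sq]
        congr 1; ring
    _ = _ := by
        rw [← integral_const_mul]
        congr 1; ext v
        rw [ENNReal.toReal_ofReal (stdGaussianDensity_nonneg v), stdGaussianDensity,
          Complex.real_smul]
        push_cast
        rw [mul_assoc, ← Complex.exp_add, real_inner_comm]
        congr 2; ring

lemma integrable_stdGaussian_iff {F : E → ℝ} :
    Integrable F (stdGaussian E) ↔ Integrable fun x => stdGaussianDensity E x * F x := by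
  rw [stdGaussian_eq_withDensity, integrable_withDensity_iff_integrable_smul'
    continuous_stdGaussianDensity.measurable.ennreal_ofReal (by simp)]
  simp [ENNReal.toReal_ofReal (stdGaussianDensity_nonneg _)]

lemma integral_stdGaussian (F : E → ℝ) :
    ∫ x, F x ∂stdGaussian E = ∫ x, stdGaussianDensity E x * F x := by
  rw [stdGaussian_eq_withDensity, integral_withDensity_eq_integral_toReal_smul
    continuous_stdGaussianDensity.measurable.ennreal_ofReal (by simp)]
  simp [ENNReal.toReal_ofReal (stdGaussianDensity_nonneg _)]

/-- **Stein's identity**: Gaussian integration by parts in the direction `v`. -/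
lemma integral_mul_inner_stdGaussian {F F' : E → ℝ} {v : E}
    (hF : ∀ x, HasLineDerivAt ℝ F (F' x) x v)
    (hFi : Integrable F (stdGaussian E)) (hF'i : Integrable F' (stdGaussian E))
    (hFv : Integrable (fun x => F x * ⟪x, v⟫_ℝ) (stdGaussian E)) :
    ∫ x, F x * ⟪x, v⟫_ℝ ∂stdGaussian E = ∫ x, F' x ∂stdGaussian E := by
  rw [integrable_stdGaussian_iff] at hFi hF'i hFv
  have h := integral_bilinear_hasLineDerivAt_right_eq_neg_left_of_integrable
    (μ := (volume : Measure E)) (f := F) (f' := F') (g := stdGaussianDensity E)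
    (g' := fun x => -(⟪x, v⟫_ℝ * stdGaussianDensity E x)) (v := v)
    (B := ContinuousLinearMap.mul ℝ ℝ)
    (hF'i.congr (.of_forall fun x => by simp [mul_comm]))
    (hFv.neg.congr (.of_forall fun x => by simp; ring))
    (hFi.congr (.of_forall fun x => by simp [mul_comm]))
    (fun x _ => hF x) (fun x _ => hasLineDerivAt_stdGaussianDensity x v)
  simp only [ContinuousLinearMap.mul_apply', mul_neg, integral_neg, neg_inj] at h
  rw [integral_stdGaussian, integral_stdGaussian]
  simp only [mul_comm (stdGaussianDensity E _), mul_assoc]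
  exact h

end Stein

section LogSumExp

variable {ι : Type*} [Fintype ι]

/-- The log-sum-exp function, a smooth surrogate of the maximum. -/
def logSumExp (w : ι → ℝ) : ℝ := Real.log (∑ j, Real.exp (w j))

/-- The softmax weights, the partial derivatives of `logSumExp`. -/
def softmax (w : ι → ℝ) (i : ι) : ℝ := Real.exp (w i) / ∑ j, Real.exp (w j)

lemma softmax_nonneg (w : ι → ℝ) (i : ι) : 0 ≤ softmax w i := by
  unfold softmax; positivity

lemma softmax_le_one (w : ι → ℝ) (i : ι) : softmax w i ≤ 1 :=
  div_le_one_of_le₀ (Finset.single_le_sum (f := fun j => Real.exp (w j))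
    (fun _ _ => (Real.exp_pos _).le) (Finset.mem_univ i)) (by positivity)

lemma abs_softmax_mul_le (w : ι → ℝ) (i : ι) (a : ℝ) : |softmax w i * a| ≤ |a| := by
  rw [abs_mul, abs_of_nonneg (softmax_nonneg w i)]
  exact mul_le_of_le_one_left (abs_nonneg a) (softmax_le_one w i)

lemma abs_softmax_deriv_le (w : ι → ℝ) (i : ι) (a : ι → ℝ) :
    |softmax w i * (a i - ∑ j, softmax w j * a j)| ≤ |a i| + ∑ j, |a j| := by
  refine (abs_softmax_mul_le _ _ _).trans ((abs_sub _ _).trans ?_)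
  gcongr
  exact (Finset.abs_sum_le_sum_abs _ _).trans
    (Finset.sum_le_sum fun j _ => abs_softmax_mul_le _ _ _)

variable {w : ℝ → ι → ℝ} {w' : ι → ℝ} {t : ℝ}

lemma hasDerivAt_sum_exp (h : ∀ i, HasDerivAt (fun s => w s i) (w' i) t) :
    HasDerivAt (fun s => ∑ j, Real.exp (w s j)) (∑ j, Real.exp (w t j) * w' j) t :=
  HasDerivAt.fun_sum fun i _ => (h i).exp

variable [Nonempty ι]

lemma sum_exp_pos (w : ι → ℝ) : 0 < ∑ j, Real.exp (w j) :=
  Finset.sum_pos (fun _ _ => Real.exp_pos _) Finset.univ_nonempty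

lemma sum_softmax (w : ι → ℝ) : ∑ i, softmax w i = 1 := by
  simp only [softmax, ← Finset.sum_div]
  exact div_self (sum_exp_pos w).ne'

lemma Continuous.logSumExp {X : Type*} [TopologicalSpace X] {f : X → ι → ℝ}
    (hf : ∀ j, Continuous fun x => f x j) : Continuous fun x => logSumExp (f x) := by
  unfold _root_.logSumExp
  exact Continuous.log (by fun_prop) fun x => (sum_exp_pos (f x)).ne'

lemma Continuous.softmax {X : Type*} [TopologicalSpace X] {f : X → ι → ℝ}
    (hf : ∀ j, Continuous fun x => f x j) (i : ι) : Continuous fun x => softmax (f x) i := by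
  unfold _root_.softmax
  exact Continuous.div (by fun_prop) (by fun_prop) fun x => (sum_exp_pos (f x)).ne'

lemma le_logSumExp (w : ι → ℝ) (i : ι) : w i ≤ logSumExp w :=
  (Real.le_log_iff_exp_le (sum_exp_pos w)).2 (Finset.single_le_sum
    (f := fun j => Real.exp (w j)) (fun _ _ => (Real.exp_pos _).le) (Finset.mem_univ i))

lemma logSumExp_le {w : ι → ℝ} {m : ℝ} (h : ∀ i, w i ≤ m) :
    logSumExp w ≤ m + Real.log (Fintype.card ι) := by
  have hc : (0 : ℝ) < Fintype.card ι := by exact_mod_cast Fintype.card_pos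
  rw [logSumExp, Real.log_le_iff_le_exp (sum_exp_pos w), Real.exp_add, Real.exp_log hc]
  calc ∑ j, Real.exp (w j) ≤ ∑ _j : ι, Real.exp m :=
        Finset.sum_le_sum fun j _ => Real.exp_le_exp.2 (h j)
    _ = _ := by simp [mul_comm]

lemma abs_logSumExp_le (w : ι → ℝ) :
    |logSumExp w| ≤ ∑ i, |w i| + Real.log (Fintype.card ι) := by
  have hi (i : ι) : |w i| ≤ ∑ j, |w j| :=
    Finset.single_le_sum (f := fun j => |w j|) (fun _ _ => abs_nonneg _) (Finset.mem_univ i)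
  have hc : 0 ≤ Real.log (Fintype.card ι) :=
    Real.log_nonneg (by exact_mod_cast Fintype.card_pos)
  refine abs_le.2 ⟨?_, logSumExp_le fun i => (le_abs_self _).trans (hi i)⟩
  obtain ⟨i⟩ := ‹Nonempty ι›
  linarith [le_logSumExp w i, neg_abs_le (w i), hi i]

lemma hasDerivAt_logSumExp (h : ∀ i, HasDerivAt (fun s => w s i) (w' i) t) :
    HasDerivAt (fun s => logSumExp (w s)) (∑ i, softmax (w t) i * w' i) t := by
  refine ((hasDerivAt_sum_exp h).log (sum_exp_pos _).ne').congr_deriv ?_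
  rw [Finset.sum_div]
  exact Finset.sum_congr rfl fun i _ => by rw [softmax]; ring

lemma hasDerivAt_softmax (h : ∀ i, HasDerivAt (fun s => w s i) (w' i) t) (i : ι) :
    HasDerivAt (fun s => softmax (w s) i)
      (softmax (w t) i * (w' i - ∑ j, softmax (w t) j * w' j)) t := by
  refine ((h i).exp.div (hasDerivAt_sum_exp h) (sum_exp_pos _).ne').congr_deriv ?_
  have hs : ∑ j, softmax (w t) j * w' j
      = (∑ j, Real.exp (w t j) * w' j) / ∑ j, Real.exp (w t j) := by
    rw [Finset.sum_div]
    exact Finset.sum_congr rfl fun i _ => by rw [softmax]; ring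
  have := (sum_exp_pos (w t)).ne'
  rw [hs, softmax]
  field_simp

end LogSumExp

section SudakovFernique

variable {ι : Type*} [Fintype ι] {E : Type*} [NormedAddCommGroup E]
  [InnerProductSpace ℝ E]

/-- The variance of the family `a` under weights `p` is half the weighted sum of its squared
mutual distances. -/
lemma sum_mul_inner_sub_eq {p : ι → ℝ} (hp : ∑ i, p i = 1) (a : ι → E) :
    ∑ i, p i * (⟪a i, a i⟫_ℝ - ∑ j, p j * ⟪a j, a i⟫_ℝ)
      = 2⁻¹ * ∑ i, ∑ j, p i * p j * ‖a i - a j‖ ^ 2 := by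
  have h1 : ∑ i, ∑ j, p i * p j * ⟪a i, a i⟫_ℝ = ∑ i, p i * ⟪a i, a i⟫_ℝ := by
    refine Finset.sum_congr rfl fun i _ => ?_
    rw [← Finset.sum_mul, ← Finset.mul_sum, hp, mul_one]
  have h2 : ∑ i, ∑ j, p i * p j * ⟪a j, a j⟫_ℝ = ∑ i, p i * ⟪a i, a i⟫_ℝ := by
    rw [Finset.sum_comm, ← h1]
    exact Finset.sum_congr rfl fun i _ => Finset.sum_congr rfl fun j _ => by ring
  have h3 : ∀ i j, p i * p j * ‖a i - a j‖ ^ 2 = p i * p j * ⟪a i, a i⟫_ℝ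
      + p i * p j * ⟪a j, a j⟫_ℝ - 2 * (p i * (p j * ⟪a j, a i⟫_ℝ)) := fun i j => by
    rw [← real_inner_self_eq_norm_sq, real_inner_sub_sub_self, real_inner_comm (a j) (a i)]
    ring
  simp only [h3, Finset.sum_sub_distrib, Finset.sum_add_distrib, h1, h2, mul_sub,
    ← Finset.mul_sum]
  ring

variable [FiniteDimensional ℝ E] [MeasurableSpace E] [BorelSpace E]

lemma integrable_norm_stdGaussian : Integrable (fun x : E => ‖x‖) (stdGaussian E) :=
  (IsGaussian.integrable_id (μ := stdGaussian E)).norm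

variable [Nonempty ι]

/-- Stein's identity for softmax weights of affine functions. -/
lemma integral_softmax_mul_inner (a : ι → E) (b : ι → ℝ) (v : E) (i : ι) :
    ∫ g, softmax (fun j => ⟪g, a j⟫_ℝ + b j) i * ⟪g, v⟫_ℝ ∂stdGaussian E
      = ∫ g, softmax (fun j => ⟪g, a j⟫_ℝ + b j) i * (⟪a i, v⟫_ℝ
        - ∑ j, softmax (fun j => ⟪g, a j⟫_ℝ + b j) j * ⟪a j, v⟫_ℝ) ∂stdGaussian E := by
  have hc (i : ι) : Continuous fun g : E => softmax (fun j => ⟪g, a j⟫_ℝ + b j) i :=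
    .softmax (fun j => by fun_prop) i
  refine integral_mul_inner_stdGaussian (fun g => ?_) ?_ ?_ ?_
  · have := hasDerivAt_softmax (w := fun t j => ⟪g + t • v, a j⟫_ℝ + b j)
      (w' := fun j => ⟪a j, v⟫_ℝ) (t := 0) (fun j => ?_) i
    · simpa [HasLineDerivAt] using this
    · have h := (((hasDerivAt_id (0 : ℝ)).smul_const v).const_add g).inner ℝ
        (hasDerivAt_const (0 : ℝ) (a j))
      simpa [real_inner_comm] using h.add_const (b j)
  · refine Integrable.of_bound (hc i).aestronglyMeasurable 1 (.of_forall fun g => ?_)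
    rw [Real.norm_eq_abs, abs_of_nonneg (softmax_nonneg _ _)]
    exact softmax_le_one _ _
  · exact Integrable.of_bound (by fun_prop) _
      (.of_forall fun g => abs_softmax_deriv_le _ i fun j => ⟪a j, v⟫_ℝ)
  · refine (integrable_norm_stdGaussian.mul_const ‖v‖).mono' (by fun_prop)
      (.of_forall fun g => ?_)
    exact (abs_softmax_mul_le _ _ _).trans (abs_real_inner_le_norm _ _)

/-- Stein's identity in the first of two independent standard Gaussian vectors. -/
lemma integral_prod_softmax_mul_inner_fst (a a' : ι → E) (c : ι → ℝ) (v : E) (i : ι) :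
    ∫ q : E × E, softmax (fun j => ⟪q.1, a j⟫_ℝ + ⟪q.2, a' j⟫_ℝ + c j) i * ⟪q.1, v⟫_ℝ
        ∂(stdGaussian E).prod (stdGaussian E)
      = ∫ q : E × E, softmax (fun j => ⟪q.1, a j⟫_ℝ + ⟪q.2, a' j⟫_ℝ + c j) i * (⟪a i, v⟫_ℝ
        - ∑ j, softmax (fun j => ⟪q.1, a j⟫_ℝ + ⟪q.2, a' j⟫_ℝ + c j) j * ⟪a j, v⟫_ℝ)
        ∂(stdGaussian E).prod (stdGaussian E) := by
  have hc (i : ι) : Continuous fun q : E × E =>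
      softmax (fun j => ⟪q.1, a j⟫_ℝ + ⟪q.2, a' j⟫_ℝ + c j) i :=
    .softmax (fun j => by fun_prop) i
  rw [integral_prod_symm, integral_prod_symm]
  · congr 1
    ext g'
    simp only [add_assoc]
    exact integral_softmax_mul_inner a (fun j => ⟪g', a' j⟫_ℝ + c j) v i
  · exact Integrable.of_bound (by fun_prop) _
      (.of_forall fun g => abs_softmax_deriv_le _ i fun j => ⟪a j, v⟫_ℝ)
  · refine ((integrable_norm_stdGaussian.comp_fst _).mul_const ‖v‖).mono' (by fun_prop)
      (.of_forall fun q => ?_)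
    exact (abs_softmax_mul_le _ _ _).trans (abs_real_inner_le_norm _ _)

/-- Stein's identity in the second of two independent standard Gaussian vectors. -/
lemma integral_prod_softmax_mul_inner_snd (a a' : ι → E) (c : ι → ℝ) (v : E) (i : ι) :
    ∫ q : E × E, softmax (fun j => ⟪q.1, a j⟫_ℝ + ⟪q.2, a' j⟫_ℝ + c j) i * ⟪q.2, v⟫_ℝ
        ∂(stdGaussian E).prod (stdGaussian E)
      = ∫ q : E × E, softmax (fun j => ⟪q.1, a j⟫_ℝ + ⟪q.2, a' j⟫_ℝ + c j) i * (⟪a' i, v⟫_ℝ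
        - ∑ j, softmax (fun j => ⟪q.1, a j⟫_ℝ + ⟪q.2, a' j⟫_ℝ + c j) j * ⟪a' j, v⟫_ℝ)
        ∂(stdGaussian E).prod (stdGaussian E) := by
  conv_lhs => rw [← integral_prod_swap]
  conv_rhs => rw [← integral_prod_swap]
  simpa only [Prod.fst_swap, Prod.snd_swap, add_comm ⟪Prod.snd _, _⟫_ℝ]
    using integral_prod_softmax_mul_inner_fst a' a c v i

/-- The derivative of the Gaussian interpolation between two families of vectors. -/
lemma hasDerivAt_integral_logSumExp (x y : ι → E) (c : ι → ℝ) (θ : ℝ) :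
    HasDerivAt (fun θ => ∫ q : E × E, logSumExp (fun j => ⟪q.1, Real.cos θ • x j⟫_ℝ
        + ⟪q.2, Real.sin θ • y j⟫_ℝ + c j) ∂(stdGaussian E).prod (stdGaussian E))
      (∫ q : E × E, ∑ i, softmax (fun j => ⟪q.1, Real.cos θ • x j⟫_ℝ
        + ⟪q.2, Real.sin θ • y j⟫_ℝ + c j) i *
          (-Real.sin θ * ⟪q.1, x i⟫_ℝ + Real.cos θ * ⟪q.2, y i⟫_ℝ)
        ∂(stdGaussian E).prod (stdGaussian E)) θ := by
  have hl (θ : ℝ) : Continuous fun q : E × E => logSumExp (fun j => ⟪q.1, Real.cos θ • x j⟫_ℝ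
      + ⟪q.2, Real.sin θ • y j⟫_ℝ + c j) :=
    .logSumExp fun j => by fun_prop
  have hs (i : ι) : Continuous fun q : E × E => softmax (fun j => ⟪q.1, Real.cos θ • x j⟫_ℝ
      + ⟪q.2, Real.sin θ • y j⟫_ℝ + c j) i :=
    .softmax (fun j => by fun_prop) i
  have h1 : Integrable (fun q : E × E => ‖q.1‖) ((stdGaussian E).prod (stdGaussian E)) :=
    integrable_norm_stdGaussian.comp_fst _
  have h2 : Integrable (fun q : E × E => ‖q.2‖) ((stdGaussian E).prod (stdGaussian E)) :=
    integrable_norm_stdGaussian.comp_snd _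
  have hin (u v : E) (r : ℝ) (hr : |r| ≤ 1) : |r * ⟪u, v⟫_ℝ| ≤ ‖u‖ * ‖v‖ := by
    rw [abs_mul]
    exact (mul_le_of_le_one_left (abs_nonneg _) hr).trans (abs_real_inner_le_norm u v)
  refine (hasDerivAt_integral_of_dominated_loc_of_deriv_le (s := univ)
    (bound := fun q => ∑ i, (‖q.1‖ * ‖x i‖ + ‖q.2‖ * ‖y i‖))
    (F' := fun θ q => ∑ i, softmax (fun j => ⟪q.1, Real.cos θ • x j⟫_ℝ
        + ⟪q.2, Real.sin θ • y j⟫_ℝ + c j) i *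
          (-Real.sin θ * ⟪q.1, x i⟫_ℝ + Real.cos θ * ⟪q.2, y i⟫_ℝ))
    Filter.univ_mem (.of_forall fun θ => (hl θ).aestronglyMeasurable) ?_ ?_ ?_ ?_ ?_).2
  · refine Integrable.mono' (g := fun q : E × E =>
      ∑ i, (‖q.1‖ * ‖x i‖ + ‖q.2‖ * ‖y i‖ + |c i|) + Real.log (Fintype.card ι))
      ((integrable_finsetSum _ fun i _ => ((h1.mul_const _).add (h2.mul_const _)).add
        (integrable_const _)).add (integrable_const _)) (hl θ).aestronglyMeasurable
      (.of_forall fun q => ?_)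
    refine (abs_logSumExp_le _).trans ?_
    gcongr with i
    refine (abs_add_le _ _).trans ?_
    gcongr
    refine (abs_add_le _ _).trans ?_
    rw [real_inner_smul_right, real_inner_smul_right]
    exact add_le_add (hin _ _ _ (Real.abs_cos_le_one θ)) (hin _ _ _ (Real.abs_sin_le_one θ))
  · exact Continuous.aestronglyMeasurable (by fun_prop)
  · refine .of_forall fun q θ _ => (Finset.abs_sum_le_sum_abs _ _).trans
      (Finset.sum_le_sum fun i _ => (abs_softmax_mul_le _ _ _).trans
      ((abs_add_le _ _).trans (add_le_add (hin _ _ _ ?_) (hin _ _ _ (Real.abs_cos_le_one θ)))))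
    rw [abs_neg]; exact Real.abs_sin_le_one θ
  · exact integrable_finsetSum _ fun i _ => (h1.mul_const _).add (h2.mul_const _)
  · refine .of_forall fun q θ _ => hasDerivAt_logSumExp (w := fun θ j =>
      ⟪q.1, Real.cos θ • x j⟫_ℝ + ⟪q.2, Real.sin θ • y j⟫_ℝ + c j) fun i => ?_
    simp only [real_inner_smul_right]
    exact (((Real.hasDerivAt_cos θ).mul_const _).add
      ((Real.hasDerivAt_sin θ).mul_const _)).add_const _

/-- The derivative of the Gaussian interpolation is nonpositive on the first quadrant when `y` has
smaller mutual distances than `x`. -/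
lemma integral_interpolation_deriv_nonpos {x y : ι → E} (hxy : ∀ i j, ‖y i - y j‖ ≤ ‖x i - x j‖)
    (c : ι → ℝ) {θ : ℝ} (hsin : 0 ≤ Real.sin θ) (hcos : 0 ≤ Real.cos θ) :
    ∫ q : E × E, ∑ i, softmax (fun j => ⟪q.1, Real.cos θ • x j⟫_ℝ
        + ⟪q.2, Real.sin θ • y j⟫_ℝ + c j) i *
          (-Real.sin θ * ⟪q.1, x i⟫_ℝ + Real.cos θ * ⟪q.2, y i⟫_ℝ)
        ∂(stdGaussian E).prod (stdGaussian E) ≤ 0 := by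
  set W : E × E → ι → ℝ := fun q j =>
    ⟪q.1, Real.cos θ • x j⟫_ℝ + ⟪q.2, Real.sin θ • y j⟫_ℝ + c j with hW
  have hs (i : ι) : Continuous fun q : E × E => softmax (W q) i :=
    .softmax (fun j => by fun_prop) i
  have i1 (i : ι) : Integrable (fun q : E × E => softmax (W q) i * ⟪q.1, x i⟫_ℝ)
      ((stdGaussian E).prod (stdGaussian E)) :=
    ((integrable_norm_stdGaussian.comp_fst _).mul_const ‖x i‖).mono' (by fun_prop)
      (.of_forall fun q => (abs_softmax_mul_le _ _ _).trans (abs_real_inner_le_norm _ _))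
  have i2 (i : ι) : Integrable (fun q : E × E => softmax (W q) i * ⟪q.2, y i⟫_ℝ)
      ((stdGaussian E).prod (stdGaussian E)) :=
    ((integrable_norm_stdGaussian.comp_snd _).mul_const ‖y i‖).mono' (by fun_prop)
      (.of_forall fun q => (abs_softmax_mul_le _ _ _).trans (abs_real_inner_le_norm _ _))
  have i3 (a : ι → E) (i : ι) : Integrable (fun q : E × E => softmax (W q) i *
      (⟪a i, a i⟫_ℝ - ∑ j, softmax (W q) j * ⟪a j, a i⟫_ℝ))
      ((stdGaussian E).prod (stdGaussian E)) :=
    Integrable.of_bound (by fun_prop) _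
      (.of_forall fun g => abs_softmax_deriv_le _ i fun j => ⟪a j, a i⟫_ℝ)
  have key (a : ι → E) : ∑ i, ∫ q : E × E, softmax (W q) i *
      (⟪a i, a i⟫_ℝ - ∑ j, softmax (W q) j * ⟪a j, a i⟫_ℝ)
        ∂(stdGaussian E).prod (stdGaussian E)
      = ∫ q : E × E, 2⁻¹ * ∑ i, ∑ j, softmax (W q) i * softmax (W q) j * ‖a i - a j‖ ^ 2
        ∂(stdGaussian E).prod (stdGaussian E) := by
    rw [← integral_finsetSum _ fun i _ => i3 a i]
    congr 1; ext q
    exact sum_mul_inner_sub_eq (sum_softmax _) a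
  have hmono : ∫ q : E × E, 2⁻¹ * ∑ i, ∑ j, softmax (W q) i * softmax (W q) j * ‖y i - y j‖ ^ 2
        ∂(stdGaussian E).prod (stdGaussian E)
      ≤ ∫ q : E × E, 2⁻¹ * ∑ i, ∑ j, softmax (W q) i * softmax (W q) j * ‖x i - x j‖ ^ 2
        ∂(stdGaussian E).prod (stdGaussian E) := by
    have hi (a : ι → E) : Integrable (fun q : E × E =>
        2⁻¹ * ∑ i, ∑ j, softmax (W q) i * softmax (W q) j * ‖a i - a j‖ ^ 2)
        ((stdGaussian E).prod (stdGaussian E)) :=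
      (integrable_finsetSum _ fun i _ => i3 a i).congr
        (.of_forall fun q => sum_mul_inner_sub_eq (sum_softmax _) a)
    refine integral_mono (hi y) (hi x) fun q => ?_
    dsimp only
    gcongr with i _ j _
    · exact mul_nonneg (softmax_nonneg _ _) (softmax_nonneg _ _)
    · exact hxy i j
  have e1 (i : ι) : ∫ q, softmax (W q) i * ⟪q.1, x i⟫_ℝ ∂(stdGaussian E).prod (stdGaussian E)
      = Real.cos θ * ∫ q : E × E, softmax (W q) i *
        (⟪x i, x i⟫_ℝ - ∑ j, softmax (W q) j * ⟪x j, x i⟫_ℝ)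
          ∂(stdGaussian E).prod (stdGaussian E) := by
    rw [hW, integral_prod_softmax_mul_inner_fst, ← integral_const_mul]
    congr 1; ext q
    simp only [real_inner_smul_left, mul_left_comm _ (Real.cos θ), ← Finset.mul_sum, ← mul_sub]
  have e2 (i : ι) : ∫ q, softmax (W q) i * ⟪q.2, y i⟫_ℝ ∂(stdGaussian E).prod (stdGaussian E)
      = Real.sin θ * ∫ q : E × E, softmax (W q) i *
        (⟪y i, y i⟫_ℝ - ∑ j, softmax (W q) j * ⟪y j, y i⟫_ℝ)
          ∂(stdGaussian E).prod (stdGaussian E) := by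
    rw [hW, integral_prod_softmax_mul_inner_snd, ← integral_const_mul]
    congr 1; ext q
    simp only [real_inner_smul_left, mul_left_comm _ (Real.sin θ), ← Finset.mul_sum, ← mul_sub]
  have hi (i : ι) : Integrable (fun q : E × E => softmax (W q) i *
      (-Real.sin θ * ⟪q.1, x i⟫_ℝ + Real.cos θ * ⟪q.2, y i⟫_ℝ))
      ((stdGaussian E).prod (stdGaussian E)) :=
    (((i1 i).const_mul (-Real.sin θ)).add ((i2 i).const_mul (Real.cos θ))).congr
      (.of_forall fun q => by simp only [Pi.add_apply]; ring)
  have hsplit (i : ι) : ∫ q : E × E, softmax (W q) i *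
      (-Real.sin θ * ⟪q.1, x i⟫_ℝ + Real.cos θ * ⟪q.2, y i⟫_ℝ)
        ∂(stdGaussian E).prod (stdGaussian E)
      = -Real.sin θ * ∫ q, softmax (W q) i * ⟪q.1, x i⟫_ℝ ∂(stdGaussian E).prod (stdGaussian E)
        + Real.cos θ *
          ∫ q, softmax (W q) i * ⟪q.2, y i⟫_ℝ ∂(stdGaussian E).prod (stdGaussian E) := by
    rw [← integral_const_mul, ← integral_const_mul,
      ← integral_add ((i1 i).const_mul _) ((i2 i).const_mul _)]
    congr 1; ext q; ring
  refine (integral_finsetSum _ fun i _ => hi i).trans_le ?_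
  simp only [hsplit, e1, e2]
  rw [Finset.sum_add_distrib]
  simp only [← Finset.mul_sum, key]
  nlinarith [mul_nonneg hsin hcos, mul_le_mul_of_nonneg_left hmono (mul_nonneg hsin hcos)]

/-- **Sudakov–Fernique inequality** for the log-sum-exp function with common offsets. -/
lemma integral_logSumExp_le {x y : ι → E} (hxy : ∀ i j, ‖y i - y j‖ ≤ ‖x i - x j‖) (c : ι → ℝ) :
    ∫ g, logSumExp (fun j => ⟪g, y j⟫_ℝ + c j) ∂stdGaussian E
      ≤ ∫ g, logSumExp (fun j => ⟪g, x j⟫_ℝ + c j) ∂stdGaussian E := by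
  have hd := hasDerivAt_integral_logSumExp x y c
  have h := antitoneOn_of_deriv_nonpos (convex_Icc 0 (Real.pi / 2))
    (fun θ _ => (hd θ).continuousAt.continuousWithinAt)
    (fun θ _ => (hd θ).differentiableAt.differentiableWithinAt) (fun θ hθ => by
      rw [interior_Icc] at hθ
      rw [(hd θ).deriv]
      exact integral_interpolation_deriv_nonpos hxy c
        (Real.sin_nonneg_of_nonneg_of_le_pi hθ.1.le (by linarith [hθ.2, Real.pi_pos]))
        (Real.cos_nonneg_of_mem_Icc ⟨by linarith [hθ.1, Real.pi_pos], hθ.2.le⟩))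
  have h' := h (left_mem_Icc.2 Real.pi_div_two_pos.le) (right_mem_Icc.2 Real.pi_div_two_pos.le)
    Real.pi_div_two_pos.le
  simp only [Real.cos_zero, Real.sin_zero, Real.cos_pi_div_two, Real.sin_pi_div_two, one_smul,
    zero_smul, inner_zero_right, zero_add, add_zero] at h'
  have e1 := integral_fun_fst (μ := stdGaussian E) (ν := stdGaussian E)
    (fun g => logSumExp fun j => ⟪g, x j⟫_ℝ + c j)
  have e2 := integral_fun_snd (μ := stdGaussian E) (ν := stdGaussian E)
    (fun g => logSumExp fun j => ⟪g, y j⟫_ℝ + c j)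
  simp only [probReal_univ, one_smul] at e1 e2
  rwa [e1, e2] at h'

end SudakovFernique

section Maxima

variable {ι : Type*} [Fintype ι] [Nonempty ι] {E : Type*} [NormedAddCommGroup E]
  [InnerProductSpace ℝ E] [FiniteDimensional ℝ E] [MeasurableSpace E] [BorelSpace E]

lemma integrable_logSumExp_inner (x : ι → E) (c : ι → ℝ) :
    Integrable (fun g => logSumExp fun j => ⟪g, x j⟫_ℝ + c j) (stdGaussian E) := by
  have hc : Continuous fun g : E => logSumExp fun j => ⟪g, x j⟫_ℝ + c j :=
    .logSumExp fun j => by fun_prop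
  refine Integrable.mono' (g := fun g : E =>
    ∑ i, (‖g‖ * ‖x i‖ + |c i|) + Real.log (Fintype.card ι))
    ((integrable_finsetSum _ fun i _ => (integrable_norm_stdGaussian.mul_const _).add
      (integrable_const _)).add (integrable_const _)) hc.aestronglyMeasurable
    (.of_forall fun g => (abs_logSumExp_le _).trans ?_)
  gcongr with i
  exact (abs_add_le _ _).trans (by gcongr; exact abs_real_inner_le_norm _ _)

/-- **Sudakov–Fernique inequality** for maxima of finite Gaussian families with common offsets:
`A` is at most the maximum of the family `y` up to `ε‖g‖`, and `B` is at least that of `x`. -/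
lemma integral_le_of_sudakovFernique {x y : ι → E} (hxy : ∀ i j, ‖y i - y j‖ ≤ ‖x i - x j‖)
    (c : ι → ℝ) {A B : E → ℝ} {ε : ℝ} (hAi : Integrable A (stdGaussian E))
    (hBi : Integrable B (stdGaussian E)) (hA : ∀ g, ∃ j, A g ≤ ⟪g, y j⟫_ℝ + c j + ε * ‖g‖)
    (hB : ∀ g j, ⟪g, x j⟫_ℝ + c j ≤ B g) :
    ∫ g, A g ∂stdGaussian E ≤ ∫ g, B g ∂stdGaussian E + ε * ∫ g, ‖g‖ ∂stdGaussian E := by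
  have hL : 0 ≤ Real.log (Fintype.card ι) :=
    Real.log_nonneg (by exact_mod_cast Fintype.card_pos)
  have key (β : ℝ) (hβ : 0 < β) : β * ∫ g, A g ∂stdGaussian E
      ≤ β * (∫ g, B g ∂stdGaussian E + ε * ∫ g, ‖g‖ ∂stdGaussian E)
        + Real.log (Fintype.card ι) := by
    have h := integral_logSumExp_le (x := fun j => β • x j) (y := fun j => β • y j)
      (fun i j => by rw [← smul_sub, ← smul_sub, norm_smul, norm_smul]; gcongr; exact hxy i j)
      (fun j => β * c j)
    have hn : Integrable (fun g : E => β * (ε * ‖g‖)) (stdGaussian E) :=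
      (integrable_norm_stdGaussian.const_mul _).const_mul _
    have h1 : ∫ g, β * A g ∂stdGaussian E
        ≤ ∫ g, (logSumExp (fun j => ⟪g, β • y j⟫_ℝ + β * c j) + β * (ε * ‖g‖))
          ∂stdGaussian E := by
      refine integral_mono (hAi.const_mul β) ((integrable_logSumExp_inner _ _).add hn)
        fun g => ?_
      obtain ⟨j, hj⟩ := hA g
      have := le_logSumExp (fun j => ⟪g, β • y j⟫_ℝ + β * c j) j
      simp only [real_inner_smul_right] at this ⊢
      nlinarith
    have h2 : ∫ g, logSumExp (fun j => ⟪g, β • x j⟫_ℝ + β * c j) ∂stdGaussian E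
        ≤ ∫ g, (β * B g + Real.log (Fintype.card ι)) ∂stdGaussian E := by
      refine integral_mono (integrable_logSumExp_inner _ _)
        ((hBi.const_mul β).add (integrable_const _)) fun g => logSumExp_le fun j => ?_
      rw [real_inner_smul_right, ← mul_add]
      exact mul_le_mul_of_nonneg_left (hB g j) hβ.le
    rw [integral_add (integrable_logSumExp_inner _ _) hn] at h1
    rw [integral_add (hBi.const_mul β) (integrable_const _)] at h2
    simp only [integral_const_mul, integral_const, probReal_univ, one_smul] at h1 h2
    linarith
  refine le_of_forall_pos_le_add fun η hη => ?_
  have hβ : 0 < (Real.log (Fintype.card ι) + 1) / η := by positivity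
  refine le_of_mul_le_mul_left ((key _ hβ).trans ?_) hβ
  rw [mul_add _ _ η, div_mul_cancel₀ _ hη.ne']
  linarith

end Maxima

section SupportFunction

lemma stdGaussianE_eq_stdGaussian (N : ℕ) : stdGaussianE N = stdGaussian (Euc N) :=
  map_pi_eq_stdGaussian

variable {N : ℕ} {K : Set (Euc N)}

lemma inner_le_suppFn (hK : IsCompact K) {z : Euc N} (hz : z ∈ K) (g : Euc N) :
    ⟪g, z⟫_ℝ ≤ suppFn K g :=
  le_csSup (hK.image (by fun_prop)).bddAbove (mem_image_of_mem _ hz)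

lemma suppFn_le_of_generates {M : Set (Euc N)} (hM : closure (convexHull ℝ M) = K)
    (hne : K.Nonempty) {g : Euc N} {b : ℝ} (h : ∀ z ∈ M, ⟪g, z⟫_ℝ ≤ b) : suppFn K g ≤ b := by
  refine csSup_le (hne.image _) ?_
  rintro _ ⟨z, hz, rfl⟩
  rw [← hM] at hz
  refine closure_minimal (s := convexHull ℝ M) (t := {z | ⟪g, z⟫_ℝ ≤ b}) (convexHull_min h ?_)
    (isClosed_le (by fun_prop) continuous_const) hz
  exact convex_halfSpace_le ⟨fun u v => inner_add_right g u v,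
    fun r u => real_inner_smul_right g u r⟩ b

lemma integrable_suppFn (hK : IsCompact K) (hne : K.Nonempty) :
    Integrable (suppFn K) (stdGaussian (Euc N)) := by
  obtain ⟨R, hR⟩ := hK.isBounded.exists_norm_le
  have hle (g g' : Euc N) : suppFn K g ≤ suppFn K g' + R * dist g g' := by
    refine csSup_le (hne.image _) ?_
    rintro _ ⟨z, hz, rfl⟩
    have h1 := inner_le_suppFn hK hz g'
    have h2 := (real_inner_le_norm (g - g') z).trans
      (mul_le_mul_of_nonneg_left (hR z hz) (norm_nonneg _))
    rw [inner_sub_left] at h2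
    rw [dist_eq_norm]
    dsimp only
    linarith
  have h0 : suppFn K 0 = 0 := by simp [suppFn, hne.image_const]
  have hR0 : 0 ≤ R := (norm_nonneg _).trans (hR _ hne.some_mem)
  have hc : Continuous (suppFn K) :=
    (LipschitzWith.of_le_add_mul ⟨R, hR0⟩ fun g g' => hle g g').continuous
  refine (integrable_norm_stdGaussian.const_mul R).mono' hc.aestronglyMeasurable
    (.of_forall fun g => ?_)
  have h1 := hle g 0
  have h2 := hle 0 g
  rw [h0, dist_zero_right] at h1
  rw [h0, dist_zero_left] at h2
  exact abs_le.2 ⟨by linarith, by linarith⟩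

/-- Hinge moments of the support function decrease under `0`-contractions. -/
lemma integral_hinge_suppFn_le {K₁ K₂ : Set (Euc N)} (hK₁ : IsCompact K₁) (hK₂ : IsCompact K₂)
    (hne₁ : K₁.Nonempty) (hne₂ : K₂.Nonempty) (h : IsZeroContractionOf K₁ K₂) (c : ℝ) :
    ∫ g, max (suppFn K₂ g - c) 0 ∂stdGaussian (Euc N)
      ≤ ∫ g, max (suppFn K₁ g - c) 0 ∂stdGaussian (Euc N) := by
  obtain ⟨M₁, M₂, φ, hM₁, hM₂, hφ, hlip, hnorm⟩ := h
  have hM₁K : M₁ ⊆ K₁ := hM₁ ▸ (subset_convexHull ℝ M₁).trans subset_closure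
  have hM₁ne : M₁.Nonempty := by
    rw [← convexHull_nonempty_iff (𝕜 := ℝ), ← closure_nonempty_iff, hM₁]; exact hne₁
  have hi {K : Set (Euc N)} (hK : IsCompact K) (hne : K.Nonempty) :
      Integrable (fun g => max (suppFn K g - c) 0) (stdGaussian (Euc N)) :=
    ((integrable_suppFn hK hne).sub (integrable_const c)).pos_part
  have approx (ε : ℝ) (hε : 0 < ε) : ∫ g, max (suppFn K₂ g - c) 0 ∂stdGaussian (Euc N)
      ≤ ∫ g, max (suppFn K₁ g - c) 0 ∂stdGaussian (Euc N)
        + ε * ∫ g, ‖g‖ ∂stdGaussian (Euc N) := by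
    obtain ⟨t, htM, htfin, htcov⟩ := exists_finite_cover_balls_of_isCompact_closure
      (hK₁.closure_of_subset hM₁K) hε
    have htne : t.Nonempty := by
      obtain ⟨z, hz⟩ := hM₁ne
      obtain ⟨i, hi, -⟩ := mem_iUnion₂.1 (htcov hz)
      exact ⟨i, hi⟩
    have := htfin.fintype
    have := htne.to_subtype
    refine integral_le_of_sudakovFernique (ι := Option t)
      (x := fun o => o.elim 0 fun i => (i : Euc N)) (y := fun o => o.elim 0 fun i => φ i)
      ?_ (fun o => o.elim 0 fun _ => -c) (hi hK₂ hne₂) (hi hK₁ hne₁) (fun g => ?_) ?_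
    · rintro (_ | i) (_ | j)
      · simp
      · simpa using hnorm j (htM j.2)
      · simpa using hnorm i (htM i.2)
      · exact hlip i (htM i.2) j (htM j.2)
    · obtain ⟨i, hmax⟩ := Finite.exists_max fun i : t => ⟪g, φ i⟫_ℝ
      have hsup : suppFn K₂ g ≤ ⟪g, φ i⟫_ℝ + ε * ‖g‖ := by
        refine suppFn_le_of_generates hM₂ hne₂ fun z hz => ?_
        rw [← hφ] at hz
        obtain ⟨x, hx, rfl⟩ := hz
        obtain ⟨j, hj, hxj⟩ := mem_iUnion₂.1 (htcov hx)
        have h1 := hmax ⟨j, hj⟩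
        have h2 := (real_inner_le_norm g (φ x - φ j)).trans (mul_le_mul_of_nonneg_left
          ((hlip x hx j (htM hj)).trans (mem_ball_iff_norm.1 hxj).le) (norm_nonneg g))
        rw [inner_sub_right] at h2
        dsimp only at h1
        linarith
      rcases le_total (suppFn K₂ g - c) 0 with h0 | h0
      · exact ⟨none, by rw [max_eq_right h0]; simp; positivity⟩
      · exact ⟨some i, by rw [max_eq_left h0]; simp only [Option.elim_some]; linarith⟩
    · rintro g (_ | i)
      · simp
      · exact le_max_of_le_left (add_le_add_left (inner_le_suppFn hK₁ (hM₁K (htM i.2)) g) (-c))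
  have hlim : Filter.Tendsto (fun ε : ℝ => ∫ g, max (suppFn K₁ g - c) 0 ∂stdGaussian (Euc N)
        + ε * ∫ g, ‖g‖ ∂stdGaussian (Euc N)) (nhdsWithin 0 (Ioi 0))
      (nhds (∫ g, max (suppFn K₁ g - c) 0 ∂stdGaussian (Euc N))) := by
    refine tendsto_nhdsWithin_of_tendsto_nhds ?_
    refine Continuous.tendsto' (by fun_prop) _ _ (by simp)
  exact ge_of_tendsto hlim (eventually_mem_nhdsWithin.mono fun ε hε => approx ε hε)

end SupportFunction


section HingeApproximation

/-- Slope of the backward chord of `f` on the grid `δ ℕ` at the node `j`;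
it vanishes for `j = 0`. -/
def gridSlope (f : ℝ → ℝ) (δ : ℝ) (j : ℕ) : ℝ :=
  (f (j * δ) - f ((j - 1 : ℕ) * δ)) / δ

/-- Approximation of `f` from below by a constant plus a combination of hinge functions. -/
def hingeApprox (f : ℝ → ℝ) (δ : ℝ) (n : ℕ) (x : ℝ) : ℝ :=
  f 0 + ∑ k ∈ Finset.range n,
    (gridSlope f δ (k + 1) - gridSlope f δ k) * max (x - (k + 1) * δ) 0

variable {f : ℝ → ℝ} {δ : ℝ}

lemma hingeApprox_eq (hδ : 0 < δ) {n j : ℕ} (hjn : j ≤ n) {x : ℝ} (hjx : j * δ ≤ x)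
    (hxj : j < n → x ≤ (j + 1) * δ) :
    hingeApprox f δ n x = f ((j - 1 : ℕ) * δ) + gridSlope f δ j * (x - j * δ) := by
  have hlin (i : ℕ) : f 0 + ∑ k ∈ Finset.range i,
      (gridSlope f δ (k + 1) - gridSlope f δ k) * (x - (k + 1) * δ)
      = f ((i - 1 : ℕ) * δ) + gridSlope f δ i * (x - i * δ) := by
    induction i with
    | zero => simp [gridSlope]
    | succ i ih =>
      rw [Finset.sum_range_succ, ← add_assoc, ih]
      have : gridSlope f δ i * δ = f (i * δ) - f ((i - 1 : ℕ) * δ) :=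
        div_mul_cancel₀ _ hδ.ne'
      push_cast
      linear_combination this
  rw [← hlin, hingeApprox, ← Finset.sum_range_add_sum_Ico _ hjn]
  rw [Finset.sum_eq_zero (s := Finset.Ico j n), add_zero]
  · congr 1
    refine Finset.sum_congr rfl fun k hk => ?_
    have hk' : (k : ℝ) + 1 ≤ j := by exact_mod_cast Finset.mem_range.1 hk
    rw [max_eq_left]
    nlinarith
  · intro k hk
    have hk' := Finset.mem_Ico.1 hk
    have hjk : (j : ℝ) ≤ k := by exact_mod_cast hk'.1
    rw [max_eq_right, mul_zero]
    nlinarith [hxj (hk'.1.trans_lt hk'.2)]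

lemma exists_grid_index (hδ : 0 < δ) (n : ℕ) {x : ℝ} (hx : 0 ≤ x) :
    ∃ j ≤ n, j * δ ≤ x ∧ (j < n → x ≤ (j + 1) * δ) := by
  refine ⟨min ⌊x / δ⌋₊ n, min_le_right _ _, ?_, fun h => ?_⟩
  · rw [← le_div_iff₀ hδ]
    exact (Nat.cast_le.2 (min_le_left _ _)).trans (Nat.floor_le (by positivity))
  · have h' : ⌊x / δ⌋₊ < n := by simpa using h
    rw [min_eq_left h'.le, ← div_le_iff₀ hδ]
    exact (Nat.lt_floor_add_one _).le

lemma gridSlope_nonneg (hm : MonotoneOn f (Ici 0)) (hδ : 0 < δ) (j : ℕ) :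
    0 ≤ gridSlope f δ j := by
  refine div_nonneg (sub_nonneg.2 (hm ?_ ?_ ?_)) hδ.le
  · exact mem_Ici.2 (by positivity)
  · exact mem_Ici.2 (by positivity)
  · gcongr
    exact Nat.sub_le _ _

lemma gridSlope_mul_le (hm : MonotoneOn f (Ici 0)) (hf : ConvexOn ℝ (Ici 0) f) (hδ : 0 < δ)
    {j : ℕ} {x : ℝ} (hx : j * δ ≤ x) : gridSlope f δ j * (x - j * δ) ≤ f x - f (j * δ) := by
  obtain rfl | hx := hx.eq_or_lt
  · simp
  cases j with
  | zero =>
    have hx0 : (0 : ℝ) ≤ x := by simpa using hx.le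
    simpa [gridSlope] using hm self_mem_Ici hx0 hx0
  | succ k =>
    have h := hf.slope_mono_adjacent (x := k * δ) (y := (k + 1 : ℕ) * δ) (z := x)
      (mem_Ici.2 (by positivity)) (mem_Ici.2 (le_trans (by positivity) hx.le))
      (by gcongr; simp) hx
    rw [le_div_iff₀ (sub_pos.2 hx)] at h
    have e : gridSlope f δ (k + 1)
        = (f ((k + 1 : ℕ) * δ) - f (k * δ)) / ((k + 1 : ℕ) * δ - k * δ) := by
      rw [gridSlope, Nat.add_sub_cancel]
      congr 1
      push_cast
      ring
    rw [e]
    exact h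

lemma gridSlope_le_succ (hm : MonotoneOn f (Ici 0)) (hf : ConvexOn ℝ (Ici 0) f) (hδ : 0 < δ)
    (j : ℕ) : gridSlope f δ j ≤ gridSlope f δ (j + 1) := by
  have h := gridSlope_mul_le hm hf hδ (j := j) (x := (j + 1 : ℕ) * δ) (by gcongr; simp)
  have e : ((j + 1 : ℕ) : ℝ) * δ - j * δ = δ := by push_cast; ring
  rw [e] at h
  rw [show gridSlope f δ (j + 1) = (f ((j + 1 : ℕ) * δ) - f (j * δ)) / δ by
    rw [gridSlope, Nat.add_sub_cancel], le_div_iff₀ hδ]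
  exact h

lemma hingeApprox_le (hm : MonotoneOn f (Ici 0)) (hf : ConvexOn ℝ (Ici 0) f) (hδ : 0 < δ)
    (n : ℕ) {x : ℝ} (hx : 0 ≤ x) : hingeApprox f δ n x ≤ f x := by
  obtain ⟨j, hjn, hjx, hxj⟩ := exists_grid_index hδ n hx
  rw [hingeApprox_eq hδ hjn hjx hxj]
  have h1 : f ((j - 1 : ℕ) * δ) ≤ f (j * δ) := by
    refine hm (mem_Ici.2 (by positivity)) (mem_Ici.2 (by positivity)) ?_
    gcongr
    exact Nat.sub_le _ _
  linarith [gridSlope_mul_le hm hf hδ hjx]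

lemma le_hingeApprox (hm : MonotoneOn f (Ici 0)) (hδ : 0 < δ) {n : ℕ} {x : ℝ} (hx : 0 ≤ x)
    (hxn : x < n * δ) : f (max 0 (x - 2 * δ)) ≤ hingeApprox f δ n x := by
  obtain ⟨j, hjn, hjx, hxj⟩ := exists_grid_index hδ n hx
  rw [hingeApprox_eq hδ hjn hjx hxj]
  have hj : j < n := hjn.lt_of_ne (by rintro rfl; linarith)
  have h1 : f (max 0 (x - 2 * δ)) ≤ f ((j - 1 : ℕ) * δ) := by
    refine hm (mem_Ici.2 (le_max_left _ _)) (mem_Ici.2 (by positivity))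
      (max_le (by positivity) ?_)
    have hcast : (j : ℝ) - 1 ≤ (j - 1 : ℕ) := by
      rw [sub_le_iff_le_add]; exact_mod_cast (by omega : j ≤ j - 1 + 1)
    nlinarith [hxj hj]
  have := mul_nonneg (gridSlope_nonneg hm hδ j) (sub_nonneg.2 hjx)
  linarith

lemma const_le_hingeApprox (hm : MonotoneOn f (Ici 0)) (hf : ConvexOn ℝ (Ici 0) f) (hδ : 0 < δ)
    (n : ℕ) (x : ℝ) : f 0 ≤ hingeApprox f δ n x :=
  le_add_of_nonneg_right <| Finset.sum_nonneg fun k _ =>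
    mul_nonneg (sub_nonneg.2 (gridSlope_le_succ hm hf hδ k)) (le_max_right _ _)

lemma tendsto_hingeApprox (hm : MonotoneOn f (Ici 0)) (hf : ConvexOn ℝ (Ici 0) f) {x : ℝ}
    (hx : 0 ≤ x) : Filter.Tendsto
      (fun m : ℕ => hingeApprox f (1 / ((m : ℝ) + 1)) ((m + 1) ^ 2) x) Filter.atTop (nhds (f x)) := by
  have hδ (m : ℕ) : (0 : ℝ) < 1 / ((m : ℝ) + 1) := by positivity
  obtain rfl | hx' := hx.eq_or_lt
  · refine tendsto_const_nhds.congr fun m => ?_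
    exact (const_le_hingeApprox hm hf (hδ m) _ _).antisymm (hingeApprox_le hm hf (hδ m) _ le_rfl)
  have hcont : ContinuousAt f x := hf.continuousOn_interior.continuousAt
    (by rw [interior_Ici]; exact Ioi_mem_nhds hx')
  have hlim : Filter.Tendsto (fun m : ℕ => f (max 0 (x - 2 * (1 / ((m : ℝ) + 1)))))
      Filter.atTop (nhds (f x)) := by
    refine hcont.tendsto.comp ?_
    have h := (tendsto_const_nhds (x := (0 : ℝ))).max ((tendsto_const_nhds (x := x)).sub
      ((tendsto_one_div_add_atTop_nhds_zero_nat (𝕜 := ℝ)).const_mul 2))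
    simpa [max_eq_right hx] using h
  refine tendsto_of_tendsto_of_tendsto_of_le_of_le' hlim tendsto_const_nhds ?_
    (.of_forall fun m => hingeApprox_le hm hf (hδ m) _ hx)
  filter_upwards [Filter.eventually_ge_atTop ⌈x⌉₊] with m hmx
  refine le_hingeApprox hm (hδ m) hx ?_
  have : x ≤ m := Nat.ceil_le.1 hmx
  have hne : (m : ℝ) + 1 ≠ 0 := by positivity
  have e : (((m + 1) ^ 2 : ℕ) : ℝ) * (1 / ((m : ℝ) + 1)) = m + 1 := by
    push_cast; field_simp
  rw [e]
  linarith

/-- The hinge (stop-loss) order implies the increasing convex order. -/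
lemma integral_comp_le_of_forall_hinge {Ω : Type*} [MeasurableSpace Ω] {μ : Measure Ω}
    [IsProbabilityMeasure μ] {X Y : Ω → ℝ} (hX : Integrable X μ) (hY : Integrable Y μ)
    (hX0 : ∀ ω, 0 ≤ X ω) (hY0 : ∀ ω, 0 ≤ Y ω)
    (h : ∀ c, ∫ ω, max (Y ω - c) 0 ∂μ ≤ ∫ ω, max (X ω - c) 0 ∂μ)
    (hm : MonotoneOn f (Ici 0)) (hf : ConvexOn ℝ (Ici 0) f)
    (hfX : Integrable (fun ω => f (X ω)) μ) (hfY : Integrable (fun ω => f (Y ω)) μ) :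
    ∫ ω, f (Y ω) ∂μ ≤ ∫ ω, f (X ω) ∂μ := by
  have hinge {Z : Ω → ℝ} (hZ : Integrable Z μ) (c : ℝ) :
      Integrable (fun ω => max (Z ω - c) 0) μ := (hZ.sub (integrable_const c)).pos_part
  have hterm {Z : Ω → ℝ} (hZ : Integrable Z μ) (δ : ℝ) (n : ℕ) :
      Integrable (fun ω => ∑ k ∈ Finset.range n, (gridSlope f δ (k + 1) - gridSlope f δ k) *
        max (Z ω - (k + 1) * δ) 0) μ :=
    integrable_finsetSum _ fun k _ => (hinge hZ _).const_mul _
  have happrox {Z : Ω → ℝ} (hZ : Integrable Z μ) (δ : ℝ) (n : ℕ) :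
      Integrable (fun ω => hingeApprox f δ n (Z ω)) μ := (integrable_const _).add (hterm hZ δ n)
  have hval {Z : Ω → ℝ} (hZ : Integrable Z μ) (δ : ℝ) (n : ℕ) :
      ∫ ω, hingeApprox f δ n (Z ω) ∂μ = f 0 + ∑ k ∈ Finset.range n,
        (gridSlope f δ (k + 1) - gridSlope f δ k) * ∫ ω, max (Z ω - (k + 1) * δ) 0 ∂μ := by
    simp only [hingeApprox]
    rw [integral_add (integrable_const _) (hterm hZ δ n),
      integral_finsetSum _ fun k _ => (hinge hZ _).const_mul _]
    simp [integral_const_mul]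
  have hδ (m : ℕ) : (0 : ℝ) < 1 / ((m : ℝ) + 1) := by positivity
  have hlim : Filter.Tendsto
      (fun m : ℕ => ∫ ω, hingeApprox f (1 / ((m : ℝ) + 1)) ((m + 1) ^ 2) (Y ω) ∂μ)
      Filter.atTop (nhds (∫ ω, f (Y ω) ∂μ)) := by
    refine tendsto_integral_of_dominated_convergence (fun ω => |f 0| + |f (Y ω)|)
      (fun m => (happrox hY _ _).aestronglyMeasurable) ((integrable_const _).add hfY.abs)
      (fun m => .of_forall fun ω => ?_)
      (.of_forall fun ω => tendsto_hingeApprox hm hf (hY0 ω))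
    have h1 := const_le_hingeApprox hm hf (hδ m) ((m + 1) ^ 2) (Y ω)
    have h2 := hingeApprox_le hm hf (hδ m) ((m + 1) ^ 2) (hY0 ω)
    rw [Real.norm_eq_abs, abs_le]
    constructor <;>
      linarith [neg_abs_le (f 0), abs_nonneg (f 0), le_abs_self (f (Y ω)), abs_nonneg (f (Y ω))]
  refine le_of_tendsto' hlim fun m => ?_
  calc ∫ ω, hingeApprox f (1 / ((m : ℝ) + 1)) ((m + 1) ^ 2) (Y ω) ∂μ
      ≤ ∫ ω, hingeApprox f (1 / ((m : ℝ) + 1)) ((m + 1) ^ 2) (X ω) ∂μ := by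
        rw [hval hY, hval hX]
        exact add_le_add le_rfl (Finset.sum_le_sum fun k _ => mul_le_mul_of_nonneg_left (h _)
          (sub_nonneg.2 (gridSlope_le_succ hm hf (hδ m) k)))
    _ ≤ ∫ ω, f (X ω) ∂μ :=
        integral_mono (happrox hX _ _) hfX fun ω => hingeApprox_le hm hf (hδ m) _ (hX0 ω)

end HingeApproximation
/-- If `K₂` is a `0`-contraction of `K₁` (convex bodies containing `0`) and
`f : [0,∞) → ℝ` is monotone and convex with both compositions integrable, then
`μ_f(K₂) ≤ μ_f(K₁)`. -/
theorem statement13 {N : ℕ} (K₁ K₂ : Set (Euc N))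
    (hK₁ : Convex ℝ K₁) (hK₁cp : IsCompact K₁) (hK₁ne : K₁.Nonempty)
    (hK₂ : Convex ℝ K₂) (hK₂cp : IsCompact K₂) (hK₂ne : K₂.Nonempty)
    (h0₁ : (0 : Euc N) ∈ K₁) (h0₂ : (0 : Euc N) ∈ K₂)
    (hcontr : IsZeroContractionOf K₁ K₂)
    (f : ℝ → ℝ) (hf_mono : MonotoneOn f (Set.Ici 0)) (hf_conv : ConvexOn ℝ (Set.Ici 0) f)
    (h1 : Integrable (fun g => f (suppFn K₁ g)) (stdGaussianE N))
    (h2 : Integrable (fun g => f (suppFn K₂ g)) (stdGaussianE N)) :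
    ∫ g, f (suppFn K₂ g) ∂(stdGaussianE N) ≤ ∫ g, f (suppFn K₁ g) ∂(stdGaussianE N) := by
  rw [stdGaussianE_eq_stdGaussian] at *
  exact integral_comp_le_of_forall_hinge (integrable_suppFn hK₁cp hK₁ne)
    (integrable_suppFn hK₂cp hK₂ne)
    (fun g => by simpa using inner_le_suppFn hK₁cp h0₁ g)
    (fun g => by simpa using inner_le_suppFn hK₂cp h0₂ g)
    (integral_hinge_suppFn_le hK₁cp hK₂cp hK₁ne hK₂ne hcontr) hf_mono hf_conv h1 h2

end
end
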